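/- Fix an integer n ≥ 4. The mixing time t_n of the adjacent-swap chain on COM_n and the mixing time t_n^L of the adjacent-swap chain on COM^L_n both satisfy the lower bound t ≥ ( (2/90)·n(n+1)(n−3) − 1 )·log 2. In particular, there exists a constant C₁ > 0 such that t_n ≥ C₁·n³ and t_n^L ≥ C₁·n³ for all n ≥ 4. -/

import Mathlib

open Finset

/-- Labels for a labeled constrained ordered matching of order `n`:
`Sum.inl i` is the leaf label `ℓ_{i+1}`, and `Sum.inr j` is the internal label `j+1`. -/
abbrev LLabel (n : ℕ) := Fin n ⊕ Fin (n - 2)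

/-- `p` is a labeled constrained ordered matching: the pairs `p 0, …, p (n-2)`
(0-indexed versions of `p_1, …, p_{n-1}`) have size two, partition the label set,
and the internal label `j+1` (i.e. `Sum.inr j`) may only appear in pair `p_k`
(1-indexed pair `k+1`) when `j + 1 < k + 1`. -/
def IsLCOM (n : ℕ) (p : Fin (n - 1) → Finset (LLabel n)) : Prop :=
  (∀ k, (p k).card = 2) ∧
  (∀ a : LLabel n, ∃ k, a ∈ p k ∧ ∀ k', a ∈ p k' → k' = k) ∧
  (∀ (j : Fin (n - 2)) (k : Fin (n - 1)), Sum.inr j ∈ p k → (j : ℕ) < (k : ℕ))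

instance (n : ℕ) : DecidablePred (IsLCOM n) := fun _ => by
  unfold IsLCOM; infer_instance

/-- The set of labeled constrained ordered matchings `COM^L_n`. -/
abbrev LCOM (n : ℕ) : Type := {p : Fin (n - 1) → Finset (LLabel n) // IsLCOM n p}

/-- Index of the pair `p_k` (1-indexed `k ∈ {1,…,n-2}`) as an element of `Fin (n-1)`. -/
def idx1 {n : ℕ} (k : Fin (n - 2)) : Fin (n - 1) := ⟨k, by have := k.isLt; omega⟩

/-- Index of the pair `p_{k+1}` as an element of `Fin (n-1)`. -/
def idx2 {n : ℕ} (k : Fin (n - 2)) : Fin (n - 1) := ⟨(k : ℕ) + 1, by have := k.isLt; omega⟩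

/-- Result of exchanging label `l1` from pair `k` with label `l2` from pair `k+1`. -/
def lswapFun (n : ℕ) (p : Fin (n - 1) → Finset (LLabel n)) (k : Fin (n - 2))
    (l1 l2 : LLabel n) : Fin (n - 1) → Finset (LLabel n) :=
  fun i =>
    if i = idx1 k then insert l2 ((p (idx1 k)).erase l1)
    else if i = idx2 k then insert l1 ((p (idx2 k)).erase l2)
    else p i

/-- The state obtained from `x` when attempting to exchange `l1 ∈ p_k` with `l2 ∈ p_{k+1}`:
the swap is performed if it yields a valid constrained ordered matching,
otherwise the chain stays at `x`. -/
def lswapDest (n : ℕ) (x : LCOM n) (k : Fin (n - 2)) (l1 l2 : LLabel n) :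
    Fin (n - 1) → Finset (LLabel n) :=
  if IsLCOM n (lswapFun n x.val k l1 l2) then lswapFun n x.val k l1 l2 else x.val

/-- Transition matrix of the adjacent-swap Markov chain on `COM^L_n`:
pick `k ∈ {1,…,n-2}` uniformly, pick `l1` uniformly from the two elements of `p_k`
and `l2` uniformly from the two elements of `p_{k+1}`, and swap them if allowed. -/
noncomputable def PL (n : ℕ) (x y : LCOM n) : ℝ :=
  (1 / ((n : ℝ) - 2)) * ∑ k : Fin (n - 2), ∑ l1 ∈ x.val (idx1 k), ∑ l2 ∈ x.val (idx2 k),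
    (1 / 4 : ℝ) * (if lswapDest n x k l1 l2 = y.val then 1 else 0)

/-- The adjacent-swap transition matrix on `COM^L_n` as a matrix. -/
noncomputable def PLmat (n : ℕ) : Matrix (LCOM n) (LCOM n) ℝ := Matrix.of (PL n)

/-- `p` is an unlabeled constrained ordered matching: each `p k` is a multiset of size two
over the symbols `Fin (n-1)` (symbol `0` stands for a leaf, symbol `j ≠ 0` for the internal
label `j`); across all pairs the symbol `0` appears `n` times and each internal label once;
and the internal label `j` may only appear in pair `p k` (1-indexed pair `k+1`) when 
`j < k + 1`, i.e. `j ≤ k`. -/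
def IsUCOMraw (n : ℕ) (p : Fin (n - 1) → Multiset (Fin (n - 1))) : Prop :=
  (∀ k, Multiset.card (p k) = 2) ∧
  (∀ s : Fin (n - 1), (∑ k, (p k).count s) = if (s : ℕ) = 0 then n else 1) ∧
  (∀ (j k : Fin (n - 1)), (j : ℕ) ≠ 0 → j ∈ p k → (j : ℕ) ≤ (k : ℕ))

instance (n : ℕ) : DecidablePred (IsUCOMraw n) := fun _ => by
  unfold IsUCOMraw; infer_instance

instance (n : ℕ) :
    DecidablePred (fun p : Fin (n - 1) → Sym (Fin (n - 1)) 2 =>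
      IsUCOMraw n (fun k => (p k : Multiset (Fin (n - 1))))) := fun _ => by
  infer_instance

/-- The set of unlabeled constrained ordered matchings `COM_n`; each pair is stored as an
unordered pair with possible repetition (`Sym _ 2`), with the validity predicate imposed on
the underlying multisets. -/
abbrev UCOM (n : ℕ) : Type :=
  {p : Fin (n - 1) → Sym (Fin (n - 1)) 2 //
    IsUCOMraw n (fun k => (p k : Multiset (Fin (n - 1))))}

/-- The sequence of size-two multisets underlying an unlabeled constrained ordered matching. -/
def uraw (n : ℕ) (x : UCOM n) : Fin (n - 1) → Multiset (Fin (n - 1)) :=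
  fun k => (x.val k : Multiset (Fin (n - 1)))

/-- Result of exchanging symbol `l1` from pair `k` with symbol `l2` from pair `k+1`. -/
def uswapFun (n : ℕ) (p : Fin (n - 1) → Multiset (Fin (n - 1))) (k : Fin (n - 2))
    (l1 l2 : Fin (n - 1)) : Fin (n - 1) → Multiset (Fin (n - 1)) :=
  fun i =>
    if i = idx1 k then l2 ::ₘ (p (idx1 k)).erase l1
    else if i = idx2 k then l1 ::ₘ (p (idx2 k)).erase l2
    else p i

/-- The state obtained from `x` when attempting to exchange `l1 ∈ p_k` with `l2 ∈ p_{k+1}`: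
the swap is performed if it yields a valid constrained ordered matching,
otherwise the chain stays at `x`. -/
def uswapDest (n : ℕ) (x : UCOM n) (k : Fin (n - 2)) (l1 l2 : Fin (n - 1)) :
    Fin (n - 1) → Multiset (Fin (n - 1)) :=
  if IsUCOMraw n (uswapFun n (uraw n x) k l1 l2) then uswapFun n (uraw n x) k l1 l2
  else uraw n x

/-- Transition matrix of the adjacent-swap Markov chain on `COM_n`:
pick `k ∈ {1,…,n-2}` uniformly, pick `l1` uniformly from the multiset `p_k`
and `l2` uniformly from the multiset `p_{k+1}` (each of the two slots of a pair
with probability 1/2), and swap them if allowed. -/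
noncomputable def PU (n : ℕ) (x y : UCOM n) : ℝ :=
  (1 / ((n : ℝ) - 2)) * ∑ k : Fin (n - 2),
    ((uraw n x (idx1 k)).map (fun l1 =>
      ((uraw n x (idx2 k)).map (fun l2 =>
        (1 / 4 : ℝ) * (if uswapDest n x k l1 l2 = uraw n y then 1 else 0))).sum)).sum

/-- The adjacent-swap transition matrix on `COM_n` as a matrix. -/
noncomputable def PUmat (n : ℕ) : Matrix (UCOM n) (UCOM n) ℝ := Matrix.of (PU n)

/-- The number of cherries of `T`: pairs all of whose elements are the leaf symbol `0`,
i.e. pairs equal to `{0,0}`. -/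
def cherries (n : ℕ) (T : UCOM n) : ℕ :=
  (Finset.univ.filter (fun k : Fin (n - 1) => ∀ a ∈ uraw n T k, (a : ℕ) = 0)).card

/-- The Tajima coalescent distribution on `COM_n`. -/
noncomputable def tajima (n : ℕ) (T : UCOM n) : ℝ :=
  (2 : ℝ) ^ (n - cherries n T - 1) / (Nat.factorial (n - 1))

/-- The (1-indexed, shifted down by one) index of the pair containing the internal label `j`:
`Ix n x j` is the unique `k` (0-indexed) with `j ∈ p_{k+1}`, so that `I_x(j) = Ix n x j + 1`. -/
noncomputable def Ix (n : ℕ) (x : UCOM n) (j : Fin (n - 1)) : ℕ :=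
  sInf {k : ℕ | ∃ h : k < n - 1, j ∈ uraw n x ⟨k, h⟩}

/-- The internal tree length `φ(x) = ∑_{j=1}^{n-2} (I_x(j) - j)`. -/
noncomputable def itl (n : ℕ) (x : UCOM n) : ℤ :=
  ∑ j ∈ Finset.univ.filter (fun j : Fin (n - 1) => (j : ℕ) ≠ 0),
    ((Ix n x j : ℤ) + 1 - (j : ℤ))

/-- The largest absolute value of an eigenvalue of `M` different from the eigenvalue `1`. -/
noncomputable def lamStar {S : Type*} [Fintype S] [DecidableEq S] (M : Matrix S S ℝ) : ℝ :=
  sSup {r : ℝ | ∃ μ : ℝ, μ ≠ 1 ∧ Module.End.HasEigenvalue (Matrix.toLin' M) μ ∧ r = |μ|}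

/-- The spectral gap `γ = 1 - λ*` of a transition matrix `M`. -/
noncomputable def specGap {S : Type*} [Fintype S] [DecidableEq S] (M : Matrix S S ℝ) : ℝ :=
  1 - lamStar M

/-- Mixing time of a chain with transition matrix `M` and stationary distribution `π`:
`max_{x₀} min { t ≥ 0 : ‖M^t(x₀,·) − π‖_TV < 1/4 }`. -/
noncomputable def mixingTime {S : Type*} [Fintype S] [DecidableEq S]
    (M : Matrix S S ℝ) (π : S → ℝ) : ℕ :=
  Finset.univ.sup fun x0 : S =>
    sInf {t : ℕ | (1 / 2 : ℝ) * ∑ y : S, |(M ^ t) x0 y - π y| < 1 / 4}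

/-- The uniform distribution on `COM^L_n`. -/
noncomputable def unifL (n : ℕ) : LCOM n → ℝ := fun _ => 1 / (Fintype.card (LCOM n) : ℝ)

/-- The mixing time `t_n` of the adjacent-swap chain on `COM_n`
(with Tajima stationary distribution). -/
noncomputable def tU (n : ℕ) : ℕ := mixingTime (PUmat n) (tajima n)

/-- The mixing time `t_n^L` of the adjacent-swap chain on `COM^L_n`
(with uniform stationary distribution). -/
noncomputable def tL (n : ℕ) : ℕ := mixingTime (PLmat n) (unifL n)

set_option linter.unusedSectionVars false

section Generic
open Matrix
variable {A B : Type*} [Fintype A] [DecidableEq A] [Fintype B] [DecidableEq B]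

structure Sto (P : Matrix A A ℝ) : Prop where
  nn : ∀ x y, 0 ≤ P x y
  one : ∀ x, ∑ y, P x y = 1

theorem Sto.mul {P Q : Matrix A A ℝ} (hP : Sto P) (hQ : Sto Q) : Sto (P * Q) := by
  constructor
  · intro x y
    rw [Matrix.mul_apply]
    exact Finset.sum_nonneg fun z _ => mul_nonneg (hP.nn _ _) (hQ.nn _ _)
  · intro x
    simp_rw [Matrix.mul_apply]
    rw [Finset.sum_comm]
    simp_rw [← Finset.mul_sum, hQ.one, mul_one, hP.one]

theorem Sto.pow {P : Matrix A A ℝ} (hP : Sto P) (t : ℕ) : Sto (P ^ t) := by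
  induction t with
  | zero =>
    constructor
    · intro x y
      rw [pow_zero, Matrix.one_apply]; split_ifs <;> norm_num
    · intro x
      simp [Matrix.one_apply]
  | succ t ih => rw [pow_succ]; exact ih.mul hP

theorem Sto.contract {P : Matrix A A ℝ} (hP : Sto P) (u : A → ℝ) :
    ∑ y, |(u ᵥ* P) y| ≤ ∑ x, |u x| := by
  calc ∑ y, |(u ᵥ* P) y| ≤ ∑ y, ∑ x, |u x| * P x y := by
        refine Finset.sum_le_sum fun y _ => ?_
        refine (Finset.abs_sum_le_sum_abs _ _).trans (le_of_eq ?_)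
        exact Finset.sum_congr rfl fun x _ => by rw [abs_mul, abs_of_nonneg (hP.nn x y)]
    _ = ∑ x, |u x| := by
        rw [Finset.sum_comm]
        simp_rw [← Finset.mul_sum, hP.one, mul_one]

theorem Sto.sum_vecMul {P : Matrix A A ℝ} (hP : Sto P) (u : A → ℝ) :
    ∑ y, (u ᵥ* P) y = ∑ x, u x := by
  simp only [Matrix.vecMul, dotProduct]
  rw [Finset.sum_comm]
  simp_rw [← Finset.mul_sum, hP.one, mul_one]

def Doeb (P : Matrix A A ℝ) : Prop := ∃ (N : ℕ) (x0 : A), ∀ x, 0 < (P ^ N) x x0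

theorem Doeb.contract {P : Matrix A A ℝ} (hP : Sto P) (hD : Doeb P) :
    ∃ (N : ℕ) (ρ : ℝ), 0 ≤ ρ ∧ ρ < 1 ∧ ∀ u : A → ℝ, ∑ x, u x = 0 →
      ∑ y, |(u ᵥ* (P ^ N)) y| ≤ ρ * ∑ x, |u x| := by
  obtain ⟨N, x0, h⟩ := hD
  have hne : (Finset.univ : Finset A).Nonempty := ⟨x0, Finset.mem_univ _⟩
  obtain ⟨z, _, hz⟩ := Finset.exists_min_image Finset.univ (fun x => (P ^ N) x x0) hne
  set δ := (P ^ N) z x0 with hδ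
  have hS := hP.pow N
  have hδ1 : δ ≤ 1 := by
    rw [hδ, ← hS.one z]
    exact Finset.single_le_sum (f := fun y => (P ^ N) z y) (fun y _ => hS.nn z y) (Finset.mem_univ x0)
  refine ⟨N, 1 - δ, by linarith, by linarith [h z], ?_⟩
  intro u hu
  have key : ∀ y, |(u ᵥ* (P ^ N)) y| ≤ ∑ x, |u x| * ((P ^ N) x y - if y = x0 then δ else 0) := by
    intro y
    have e : (u ᵥ* (P ^ N)) y = ∑ x, u x * ((P ^ N) x y - if y = x0 then δ else 0) := by
      simp_rw [mul_sub, Finset.sum_sub_distrib, ← Finset.sum_mul, hu]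
      simp [Matrix.vecMul, dotProduct]
    rw [e]
    refine (Finset.abs_sum_le_sum_abs _ _).trans (le_of_eq ?_)
    refine Finset.sum_congr rfl fun x _ => ?_
    rw [abs_mul, abs_of_nonneg (a := _ - _)]
    split_ifs with hy
    · subst hy; linarith [hz x (Finset.mem_univ x)]
    · linarith [hS.nn x y]
  refine (Finset.sum_le_sum fun y _ => key y).trans (le_of_eq ?_)
  rw [Finset.sum_comm, Finset.mul_sum]
  refine Finset.sum_congr rfl fun x _ => ?_
  rw [← Finset.mul_sum, Finset.sum_sub_distrib, hS.one]
  simp [mul_comm]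

theorem stat_pow {P : Matrix A A ℝ} {π : A → ℝ} (h : π ᵥ* P = π) (t : ℕ) : π ᵥ* (P ^ t) = π := by
  induction t with
  | zero => simp
  | succ t ih => rw [pow_succ, ← Matrix.vecMul_vecMul, ih, h]

theorem stat_unique {P : Matrix A A ℝ} (hP : Sto P) (hD : Doeb P) {π ν : A → ℝ}
    (h1 : π ᵥ* P = π) (h2 : ν ᵥ* P = ν) (h : ∑ x, π x = ∑ x, ν x) : π = ν := by
  obtain ⟨N, ρ, h0, hρ, hc⟩ := hD.contract hP
  have := hc (π - ν) (by simp [h])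
  rw [Matrix.sub_vecMul, stat_pow h1, stat_pow h2] at this
  have hn : 0 ≤ ∑ x, |(π - ν) x| := Finset.sum_nonneg fun _ _ => abs_nonneg _
  have hz : ∑ x, |(π - ν) x| = 0 := by nlinarith
  rw [Finset.sum_eq_zero_iff_of_nonneg (fun _ _ => abs_nonneg _)] at hz
  funext x
  have := hz x (Finset.mem_univ x)
  rw [abs_eq_zero] at this
  simpa [sub_eq_zero] using this

theorem row_eq (M : Matrix A A ℝ) (x : A) : M x = Pi.single x 1 ᵥ* M := by
  rw [Matrix.single_one_vecMul]; rfl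

theorem tv_conv {P : Matrix A A ℝ} (hP : Sto P) (hD : Doeb P) {π : A → ℝ}
    (h1 : π ᵥ* P = π) (hs : ∑ x, π x = 1) (x : A) :
    ∃ t : ℕ, (1 / 2 : ℝ) * ∑ y, |(P ^ t) x y - π y| < 1 / 4 := by
  obtain ⟨N, ρ, h0, hρ, hc⟩ := hD.contract hP
  set u : A → ℝ := Pi.single x 1 - π with hu
  have hu0 : ∑ x, u x = 0 := by simp [hu, hs]
  have hb : ∀ m : ℕ, ∑ y, |(u ᵥ* (P ^ (N * m))) y| ≤ ρ ^ m * ∑ x, |u x| := by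
    intro m
    induction m with
    | zero => simp
    | succ m ih =>
      rw [Nat.mul_succ, pow_add, ← Matrix.vecMul_vecMul]
      refine (hc _ (by rw [(hP.pow _).sum_vecMul, hu0])).trans ?_
      rw [pow_succ]
      nlinarith
  have hlim : Filter.Tendsto (fun m : ℕ => ρ ^ m * ∑ x, |u x|) Filter.atTop (nhds 0) := by
    simpa using (tendsto_pow_atTop_nhds_zero_of_lt_one h0 hρ).mul_const (∑ x, |u x|)
  obtain ⟨m, hm⟩ := (hlim.eventually (gt_mem_nhds (show (0:ℝ) < 1/2 by norm_num))).exists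
  refine ⟨N * m, ?_⟩
  have e : ∀ y, (P ^ (N * m)) x y - π y = (u ᵥ* (P ^ (N * m))) y := by
    intro y
    rw [hu, Matrix.sub_vecMul, stat_pow h1, row_eq (P ^ (N * m)) x]; rfl
  simp_rw [e]
  linarith [hb m]

theorem tv_mono {P : Matrix A A ℝ} (hP : Sto P) {π : A → ℝ}
    (h1 : π ᵥ* P = π) (x : A) (t s : ℕ) :
    ∑ y, |(P ^ (t + s)) x y - π y| ≤ ∑ y, |(P ^ t) x y - π y| := by
  have e : ∀ t y, (P ^ t) x y - π y = ((Pi.single x 1 - π) ᵥ* (P ^ t)) y := by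
    intro t y
    rw [Matrix.sub_vecMul, stat_pow h1, row_eq (P ^ t) x]; rfl
  simp_rw [e, pow_add, ← Matrix.vecMul_vecMul]
  exact (hP.pow s).contract _

theorem tv_at_mix {P : Matrix A A ℝ} (hP : Sto P) (hD : Doeb P) {π : A → ℝ}
    (h1 : π ᵥ* P = π) (hs : ∑ x, π x = 1) (x : A) :
    (1 / 2 : ℝ) * ∑ y, |(P ^ (mixingTime P π)) x y - π y| < 1 / 4 := by
  have hmem := Nat.sInf_mem (s := {t : ℕ | (1 / 2 : ℝ) * ∑ y, |(P ^ t) x y - π y| < 1 / 4})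
    (tv_conv hP hD h1 hs x)
  have hle : sInf {t : ℕ | (1 / 2 : ℝ) * ∑ y, |(P ^ t) x y - π y| < 1 / 4} ≤ mixingTime P π :=
    Finset.le_sup (f := fun x0 : A =>
      sInf {t : ℕ | (1 / 2 : ℝ) * ∑ y, |(P ^ t) x0 y - π y| < 1 / 4}) (Finset.mem_univ x)
  obtain ⟨s, hs'⟩ := Nat.exists_eq_add_of_le hle
  rw [hs']
  have := tv_mono hP h1 x (sInf {t : ℕ | (1 / 2 : ℝ) * ∑ y, |(P ^ t) x y - π y| < 1 / 4}) s
  have h3 : (1 / 2 : ℝ) * ∑ y, |(P ^ (sInf {t : ℕ | (1 / 2 : ℝ) * ∑ y, |(P ^ t) x y - π y| < 1 / 4})) x y - π y| < 1 / 4 := hmem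
  linarith

theorem fun_contract {P : Matrix A A ℝ} (hP : Sto P) (hD : Doeb P) {π : A → ℝ}
    (h1 : π ᵥ* P = π) (hs : ∑ x, π x = 1) {g : A → ℝ} {M : ℝ} (hM : ∀ x, |g x| ≤ M)
    (hg : ∑ x, π x * g x = 0) (x : A) :
    |((P ^ (mixingTime P π)) *ᵥ g) x| ≤ (1 / 2) * M := by
  have h := tv_at_mix hP hD h1 hs x
  set T := mixingTime P π
  have e : ((P ^ T) *ᵥ g) x = ∑ y, ((P ^ T) x y - π y) * g y := by
    simp_rw [sub_mul, Finset.sum_sub_distrib, hg, sub_zero]; rfl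
  have hM0 : 0 ≤ M := (abs_nonneg _).trans (hM x)
  rw [e]
  calc _ ≤ ∑ y, |(P ^ T) x y - π y| * M := by
        refine (Finset.abs_sum_le_sum_abs _ _).trans (Finset.sum_le_sum fun y _ => ?_)
        rw [abs_mul]; exact mul_le_mul_of_nonneg_left (hM y) (abs_nonneg _)
    _ = (∑ y, |(P ^ T) x y - π y|) * M := by rw [Finset.sum_mul]
    _ ≤ _ := by
      apply mul_le_mul_of_nonneg_right _ hM0
      linarith

def Lump (Q : Matrix A A ℝ) (P : Matrix B B ℝ) (q : A → B) : Prop :=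
  ∀ f : B → ℝ, Q *ᵥ (f ∘ q) = (P *ᵥ f) ∘ q

theorem Lump.pow {Q : Matrix A A ℝ} {P : Matrix B B ℝ} {q : A → B} (h : Lump Q P q) (t : ℕ) :
    Lump (Q ^ t) (P ^ t) q := by
  induction t with
  | zero => intro f; simp
  | succ t ih =>
    intro f
    rw [pow_succ, ← Matrix.mulVec_mulVec, h f, ih, pow_succ, ← Matrix.mulVec_mulVec]

theorem Lump.apply {Q : Matrix A A ℝ} {P : Matrix B B ℝ} {q : A → B} (h : Lump Q P q) (a : A) (b : B) :
    P (q a) b = ∑ a', if q a' = b then Q a a' else 0 := by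
  have := congrFun (h (Pi.single b 1)) a
  simp only [Function.comp, Matrix.mulVec, dotProduct, Pi.single_apply, mul_ite, mul_one, mul_zero,
    Finset.sum_ite_eq', Finset.mem_univ, if_true] at this
  exact this.symm

theorem Lump.doeb {Q : Matrix A A ℝ} {P : Matrix B B ℝ} {q : A → B} (h : Lump Q P q)
    (hQ : Sto Q) (hq : Function.Surjective q) (hD : Doeb Q) : Doeb P := by
  obtain ⟨N, x0, hx⟩ := hD
  refine ⟨N, q x0, fun y => ?_⟩
  obtain ⟨x, rfl⟩ := hq y
  rw [(h.pow N).apply]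
  refine lt_of_lt_of_le (hx x) ?_
  have := Finset.single_le_sum (f := fun a' => if q a' = q x0 then (Q ^ N) x a' else 0)
    (fun a' _ => by
      show 0 ≤ if q a' = q x0 then (Q ^ N) x a' else 0
      split_ifs
      · exact (hQ.pow N).nn _ _
      · exact le_rfl) (Finset.mem_univ x0)
  simpa using this

/-- pushforward -/
def push (q : A → B) (π : A → ℝ) (b : B) : ℝ := ∑ a, if q a = b then π a else 0

theorem push_sum (q : A → B) (π : A → ℝ) (f : B → ℝ) :
    ∑ b, push q π b * f b = ∑ a, π a * f (q a) := by
  unfold push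
  simp_rw [Finset.sum_mul]
  rw [Finset.sum_comm]
  simp

theorem Lump.stat {Q : Matrix A A ℝ} {P : Matrix B B ℝ} {q : A → B} (h : Lump Q P q)
    {π : A → ℝ} (hπ : π ᵥ* Q = π) : push q π ᵥ* P = push q π := by
  funext b
  have h1 : (push q π ᵥ* P) b = ∑ b', push q π b' * P b' b := rfl
  rw [h1, push_sum q π (fun b' => P b' b)]
  simp_rw [h.apply, Finset.mul_sum]
  rw [Finset.sum_comm]
  unfold push
  refine Finset.sum_congr rfl fun a' _ => ?_
  split_ifs
  · exact congrFun hπ a'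
  · simp

theorem Lump.tv {Q : Matrix A A ℝ} {P : Matrix B B ℝ} {q : A → B} (h : Lump Q P q)
    (π : A → ℝ) (t : ℕ) (a : A) :
    ∑ b, |(P ^ t) (q a) b - push q π b| ≤ ∑ a', |(Q ^ t) a a' - π a'| := by
  have : ∀ b, |(P ^ t) (q a) b - push q π b| ≤ ∑ a', if q a' = b then |(Q ^ t) a a' - π a'| else 0 := by
    intro b
    rw [(h.pow t).apply, push, ← Finset.sum_sub_distrib]
    refine (Finset.abs_sum_le_sum_abs _ _).trans (Finset.sum_le_sum fun a' _ => ?_)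
    split_ifs <;> simp
  refine (Finset.sum_le_sum fun b _ => this b).trans (le_of_eq ?_)
  rw [Finset.sum_comm]
  simp

theorem Lump.mix_le {Q : Matrix A A ℝ} {P : Matrix B B ℝ} {q : A → B} (h : Lump Q P q)
    (hQ : Sto Q) (hD : Doeb Q) {π : A → ℝ} (hπ : π ᵥ* Q = π) (hs : ∑ x, π x = 1)
    (hq : Function.Surjective q) : mixingTime P (push q π) ≤ mixingTime Q π := by
  refine Finset.sup_le fun y _ => ?_
  obtain ⟨x, rfl⟩ := hq y
  apply Nat.sInf_le
  have h1 := tv_at_mix hQ hD hπ hs x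
  have h2 := h.tv π (mixingTime Q π) x
  show (1 / 2 : ℝ) * _ < _
  linarith

theorem logconv {Q : Matrix A A ℝ} (hsym : Qᵀ = Q) (F : A → ℝ) {lam : ℝ} (hl : 0 < lam)
    (hF : 0 < F ⬝ᵥ F) (h1 : lam * (F ⬝ᵥ F) ≤ F ⬝ᵥ (Q *ᵥ F)) (t : ℕ) :
    lam ^ (2 * t) * (F ⬝ᵥ F) ≤ ((Q ^ t) *ᵥ F) ⬝ᵥ ((Q ^ t) *ᵥ F) := by
  have cs : ∀ u v : A → ℝ, (u ⬝ᵥ v) ^ 2 ≤ (u ⬝ᵥ u) * (v ⬝ᵥ v) := by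
    intro u v
    have := Finset.sum_mul_sq_le_sq_mul_sq Finset.univ u v
    simpa [dotProduct, sq] using this
  have sa : ∀ u v : A → ℝ, (Q *ᵥ u) ⬝ᵥ v = u ⬝ᵥ (Q *ᵥ v) := by
    intro u v
    rw [Matrix.dotProduct_mulVec, ← Matrix.mulVec_transpose, hsym]
  set b : ℕ → ℝ := fun t => ((Q ^ t) *ᵥ F) ⬝ᵥ ((Q ^ t) *ᵥ F) with hb
  have hb0 : b 0 = F ⬝ᵥ F := by simp [hb]
  have hst : ∀ t, (Q ^ (t+1)) *ᵥ F = Q *ᵥ ((Q ^ t) *ᵥ F) := by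
    intro t; rw [pow_succ', Matrix.mulVec_mulVec]
  have hlc : ∀ t, b (t+1) ^ 2 ≤ b t * b (t+2) := by
    intro t
    have := cs ((Q ^ t) *ᵥ F) ((Q ^ (t+2)) *ᵥ F)
    have e : ((Q ^ t) *ᵥ F) ⬝ᵥ ((Q ^ (t+2)) *ᵥ F) = b (t+1) := by
      simp only [hb]
      rw [hst (t+1), ← sa, ← hst]
    rw [e] at this; exact this
  have hb1 : lam ^ 2 * b 0 ≤ b 1 := by
    have := cs F (Q *ᵥ F)
    have e : b 1 = (Q *ᵥ F) ⬝ᵥ (Q *ᵥ F) := by simp [hb]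
    rw [hb0, e]
    have h3 : (lam * (F ⬝ᵥ F)) ^ 2 ≤ (F ⬝ᵥ F) * ((Q *ᵥ F) ⬝ᵥ (Q *ᵥ F)) :=
      (pow_le_pow_left₀ (by positivity) h1 2).trans this
    have h4 : (F ⬝ᵥ F) * (lam ^ 2 * (F ⬝ᵥ F)) ≤ (F ⬝ᵥ F) * ((Q *ᵥ F) ⬝ᵥ (Q *ᵥ F)) := by
      nlinarith
    exact le_of_mul_le_mul_left h4 hF
  have main : ∀ t, 0 < b t ∧ lam ^ 2 * b t ≤ b (t+1) := by
    intro t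
    induction t with
    | zero => exact ⟨by rw [hb0]; exact hF, hb1⟩
    | succ t ih =>
      obtain ⟨hp, hle⟩ := ih
      have hp' : 0 < b (t+1) := lt_of_lt_of_le (by positivity) hle
      refine ⟨hp', ?_⟩
      have := hlc t
      have h5 : b t * (lam ^ 2 * b (t+1)) ≤ b t * b (t+1+1) := by
        have : b (t+1) * (lam ^ 2 * b t) ≤ b (t+1) * b (t+1) := mul_le_mul_of_nonneg_left hle hp'.le
        calc _ = b (t+1) * (lam ^ 2 * b t) := by ring
          _ ≤ _ := this
          _ = b (t+1) ^ 2 := by ring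
          _ ≤ _ := hlc t
      exact le_of_mul_le_mul_left h5 hp
  have : lam ^ (2 * t) * b 0 ≤ b t := by
    induction t with
    | zero => simp
    | succ t ih =>
      calc _ = lam ^ 2 * (lam ^ (2 * t) * b 0) := by ring
        _ ≤ lam ^ 2 * b t := by gcongr
        _ ≤ _ := (main t).2
  rw [hb0] at this
  exact this

theorem iter_contract {P : Matrix B B ℝ} (hP : Sto P) (hD : Doeb P) {π : B → ℝ}
    (h1 : π ᵥ* P = π) (hs : ∑ x, π x = 1) {g : B → ℝ} {M : ℝ} (hM : ∀ x, |g x| ≤ M)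
    (hg : ∑ x, π x * g x = 0) (m : ℕ) (x : B) :
    |((P ^ (mixingTime P π * m)) *ᵥ g) x| ≤ (1 / 2) ^ m * M := by
  induction m generalizing x with
  | zero => simpa using hM x
  | succ m ih =>
    rw [Nat.mul_succ, add_comm, pow_add, ← Matrix.mulVec_mulVec]
    refine (fun_contract hP hD h1 hs ih ?_ x).trans (le_of_eq (by ring))
    have : π ⬝ᵥ ((P ^ (mixingTime P π * m)) *ᵥ g) = π ⬝ᵥ g := by
      rw [Matrix.dotProduct_mulVec, stat_pow h1]
    exact this.trans hg

theorem lower {Q : Matrix A A ℝ} {P : Matrix B B ℝ} {r : A → B} (h : Lump Q P r)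
    (hsym : Qᵀ = Q) (hP : Sto P) (hD : Doeb P) {π : B → ℝ}
    (h1 : π ᵥ* P = π) (hs : ∑ x, π x = 1) {g : B → ℝ} (hg : ∑ x, π x * g x = 0)
    (hF : 0 < (g ∘ r) ⬝ᵥ (g ∘ r)) :
    1 ≤ mixingTime P π ∧ ∀ lam : ℝ, 0 < lam →
      lam * ((g ∘ r) ⬝ᵥ (g ∘ r)) ≤ (g ∘ r) ⬝ᵥ (Q *ᵥ (g ∘ r)) → lam ^ mixingTime P π ≤ 1 / 2 := by
  obtain ⟨M, hM⟩ : ∃ M, ∀ x, |g x| ≤ M :=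
    ⟨∑ x, |g x|, fun x => Finset.single_le_sum (f := fun x => |g x|) (fun _ _ => abs_nonneg _) (Finset.mem_univ x)⟩
  have it := iter_contract hP hD h1 hs hM hg
  set T := mixingTime P π
  have ub : ∀ m : ℕ, ((Q ^ (T * m)) *ᵥ (g ∘ r)) ⬝ᵥ ((Q ^ (T * m)) *ᵥ (g ∘ r)) ≤
      Fintype.card A * ((1 / 2) ^ m * M) ^ 2 := by
    intro m
    rw [h.pow]
    have : ∀ a ∈ (Finset.univ : Finset A), ((P ^ (T * m)) *ᵥ g) (r a) * ((P ^ (T * m)) *ᵥ g) (r a)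
        ≤ ((1 / 2) ^ m * M) ^ 2 := by
      intro a _
      have := it m (r a)
      rw [← sq, ← sq_abs]
      exact pow_le_pow_left₀ (abs_nonneg _) this 2
    have h2 := Finset.sum_le_card_nsmul _ _ _ this
    simpa [dotProduct] using h2
  have lim : ∀ κ : ℝ, 1 < κ → ∃ m : ℕ, Fintype.card A * M ^ 2 < κ ^ m * ((g ∘ r) ⬝ᵥ (g ∘ r)) := by
    intro κ hκ
    obtain ⟨m, hm⟩ := pow_unbounded_of_one_lt (Fintype.card A * M ^ 2 / ((g ∘ r) ⬝ᵥ (g ∘ r))) hκ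
    exact ⟨m, (div_lt_iff₀ hF).1 hm⟩
  constructor
  · by_contra hT
    have hT0 : T = 0 := by omega
    obtain ⟨m, hm⟩ := lim 4 (by norm_num)
    have := ub m
    rw [hT0, zero_mul, pow_zero, Matrix.one_mulVec, mul_pow, ← pow_mul, mul_comm m 2, pow_mul] at this
    have e : (4:ℝ) ^ m * ((1 / 2) ^ 2) ^ m = 1 := by rw [← mul_pow]; norm_num
    have h4 : (0:ℝ) < 4 ^ m := by positivity
    have := mul_le_mul_of_nonneg_left this h4.le
    have e2 : (4:ℝ) ^ m * (Fintype.card A * (((1 / 2) ^ 2) ^ m * M ^ 2)) = Fintype.card A * M ^ 2 := by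
      linear_combination (Fintype.card A * M ^ 2 : ℝ) * e
    rw [e2] at this
    linarith
  · intro lam hl hlam
    by_contra hc
    push Not at hc
    obtain ⟨m, hm⟩ := lim ((2 * lam ^ T) ^ 2) (by
      have : 1 < 2 * lam ^ T := by linarith
      nlinarith)
    have lo := logconv hsym _ hl hF hlam (T * m)
    have := lo.trans (ub m)
    have e : (4:ℝ) ^ m * ((1 / 2) ^ 2) ^ m = 1 := by rw [← mul_pow]; norm_num
    have h4 : (0:ℝ) < 4 ^ m := by positivity
    have := mul_le_mul_of_nonneg_left this h4.le
    have e2 : (4:ℝ) ^ m * (Fintype.card A * ((1 / 2) ^ m * M) ^ 2) = Fintype.card A * M ^ 2 := by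
      rw [mul_pow, ← pow_mul, mul_comm m 2, pow_mul]
      linear_combination (Fintype.card A * M ^ 2 : ℝ) * e
    rw [e2] at this
    have e3 : ((2 * lam ^ T) ^ 2) ^ m = 4 ^ m * lam ^ (2 * (T * m)) := by
      rw [mul_pow, mul_pow, ← pow_mul lam, ← pow_mul lam]; norm_num; ring_nf
    rw [e3] at hm
    linarith

theorem final_bound {T : ℕ} {ρ : ℝ} (h0 : 0 < ρ) (h1 : ρ < 1) (h : (1 - ρ) ^ T ≤ 1 / 2) :
    (1 / ρ - 1) * Real.log 2 ≤ T := by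
  have hl : 0 < 1 - ρ := by linarith
  have h2 := Real.log_le_log (by positivity) h
  rw [Real.log_pow, one_div, Real.log_inv] at h2
  have h3 := Real.one_sub_inv_le_log_of_pos hl
  have h4 : Real.log 2 ≤ T * ((1 - ρ)⁻¹ - 1) := by
    have : (0:ℝ) ≤ T := by positivity
    nlinarith
  have e : (1 - ρ)⁻¹ - 1 = ρ / (1 - ρ) := by field_simp; ring
  rw [e] at h4
  have hc : 0 ≤ 1 / ρ - 1 := by rw [sub_nonneg, le_div_iff₀ h0]; linarith
  calc _ ≤ (1 / ρ - 1) * (T * (ρ / (1 - ρ))) := by gcongr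
    _ = T := by field_simp
end Generic

section VPart
open Matrix

theorem msum_comm {α β : Type*} [Fintype β] (s : Multiset α) (h : α → β → ℝ) :
    ∑ z, (s.map (fun l => h l z)).sum = (s.map fun l => ∑ z, h l z).sum := by
  induction s using Multiset.induction with
  | empty => simp
  | cons a s ih => simp [Finset.sum_add_distrib, ih]

def uD (n : ℕ) (x : UCOM n) (k : Fin (n - 2)) (l1 l2 : Fin (n - 1)) : UCOM n :=
  if h : IsUCOMraw n (uswapFun n (uraw n x) k l1 l2) then
    ⟨fun i => ⟨uswapFun n (uraw n x) k l1 l2 i, h.1 i⟩, h⟩ else x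

theorem uraw_inj {n : ℕ} {x y : UCOM n} (h : uraw n x = uraw n y) : x = y := by
  apply Subtype.ext
  funext k
  exact Subtype.ext (congrFun h k)

theorem uraw_uD (n : ℕ) (x : UCOM n) (k : Fin (n - 2)) (l1 l2 : Fin (n - 1)) :
    uraw n (uD n x k l1 l2) = uswapDest n x k l1 l2 := by
  unfold uD uswapDest
  split_ifs with h
  · rfl
  · rfl

theorem PU_act (n : ℕ) (f : UCOM n → ℝ) (x : UCOM n) :
    (PUmat n *ᵥ f) x = (1 / ((n : ℝ) - 2)) * ∑ k : Fin (n - 2),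
    ((uraw n x (idx1 k)).map (fun l1 =>
      ((uraw n x (idx2 k)).map (fun l2 => (1 / 4 : ℝ) * f (uD n x k l1 l2))).sum)).sum := by
  have : (PUmat n *ᵥ f) x = ∑ z, PU n x z * f z := rfl
  rw [this]
  simp_rw [PU, mul_assoc, ← Finset.mul_sum, Finset.sum_mul]
  rw [Finset.sum_comm]
  congr 1
  refine Finset.sum_congr rfl fun k _ => ?_
  simp_rw [← Multiset.sum_map_mul_right]
  rw [msum_comm]
  congr 1
  refine Multiset.map_congr rfl fun l1 _ => ?_
  rw [msum_comm]
  congr 1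
  refine Multiset.map_congr rfl fun l2 _ => ?_
  rw [← uraw_uD]
  rw [Finset.sum_eq_single (uD n x k l1 l2)]
  · simp
  · intro b _ hb
    rw [if_neg (fun h => hb (uraw_inj h).symm)]; simp
  · simp

abbrev Slot (n : ℕ) := Fin (n - 1) × Bool

def vraw {n : ℕ} (w : Slot n → Fin (n - 1)) (k : Fin (n - 1)) : Multiset (Fin (n - 1)) :=
  {w (k, false), w (k, true)}

abbrev VC (n : ℕ) := {w : Slot n → Fin (n - 1) // IsUCOMraw n (vraw w)}

def vsw {n : ℕ} (k : Fin (n - 2)) (b1 b2 : Bool) : Equiv.Perm (Slot n) :=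
  Equiv.swap (idx1 k, b1) (idx2 k, b2)

def vD {n : ℕ} (k : Fin (n - 2)) (b1 b2 : Bool) (v : VC n) : VC n :=
  if h : IsUCOMraw n (vraw (v.1 ∘ vsw k b1 b2)) then ⟨_, h⟩ else v

theorem vD_invol {n : ℕ} (k : Fin (n - 2)) (b1 b2 : Bool) : Function.Involutive (vD (n := n) k b1 b2) := by
  intro v
  by_cases h : IsUCOMraw n (vraw (v.1 ∘ vsw k b1 b2))
  · have e : vD k b1 b2 v = ⟨_, h⟩ := dif_pos h
    have e3 : (v.1 ∘ vsw k b1 b2) ∘ vsw k b1 b2 = v.1 := by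
      funext s; simp [vsw]
    rw [e, vD, dif_pos (by show IsUCOMraw n (vraw ((v.1 ∘ vsw k b1 b2) ∘ vsw k b1 b2)); rw [e3]; exact v.2)]
    exact Subtype.ext e3
  · have e : vD k b1 b2 v = v := dif_neg h
    rw [e, e]

noncomputable def QV (n : ℕ) : Matrix (VC n) (VC n) ℝ := Matrix.of fun v v' =>
  (1 / ((n : ℝ) - 2)) * ∑ p : Fin (n - 2) × Bool × Bool,
    (1 / 4 : ℝ) * (if vD p.1 p.2.1 p.2.2 v = v' then 1 else 0)

theorem QV_symm (n : ℕ) : (QV n)ᵀ = QV n := by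
  refine Matrix.ext fun v v' => ?_
  rw [Matrix.transpose_apply]
  unfold QV
  rw [Matrix.of_apply, Matrix.of_apply]
  congr 1
  refine Finset.sum_congr rfl fun p _ => ?_
  congr 1
  by_cases h : vD p.1 p.2.1 p.2.2 v = v'
  · rw [if_pos h, if_pos]
    rw [← h]; exact vD_invol _ _ _ v
  · rw [if_neg h, if_neg]
    intro h'
    apply h
    rw [← h']; exact vD_invol _ _ _ v'

theorem QV_act (n : ℕ) (f : VC n → ℝ) (x : VC n) :
    (QV n *ᵥ f) x = (1 / ((n : ℝ) - 2)) * ∑ p : Fin (n - 2) × Bool × Bool,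
      (1 / 4 : ℝ) * f (vD p.1 p.2.1 p.2.2 x) := by
  have : (QV n *ᵥ f) x = ∑ z, QV n x z * f z := rfl
  rw [this]
  simp_rw [QV, Matrix.of_apply, ← Finset.mul_sum, mul_assoc, ← Finset.mul_sum, Finset.sum_mul]
  rw [Finset.sum_comm]
  simp

def rV {n : ℕ} (v : VC n) : UCOM n := ⟨fun k => ⟨vraw v.1 k, rfl⟩, v.2⟩

theorem uswap_vraw {n : ℕ} (w : Slot n → Fin (n - 1)) (k : Fin (n - 2)) (b1 b2 : Bool) :
    uswapFun n (vraw w) k (w (idx1 k, b1)) (w (idx2 k, b2)) = vraw (w ∘ vsw k b1 b2) := by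
  have hne : idx1 k ≠ idx2 k := by
    intro h; have := congrArg Fin.val h; simp [idx1, idx2] at this
  funext i
  unfold uswapFun
  split_ifs with h1 h2
  · subst h1
    cases b1 <;> cases b2 <;> simp [vraw, vsw, Equiv.swap_apply_def, hne, Multiset.erase_cons_tail_of_mem, Multiset.insert_eq_cons] 
    all_goals exact Multiset.pair_comm _ _
  · subst h2
    cases b1 <;> cases b2 <;> simp [vraw, vsw, Equiv.swap_apply_def, hne.symm, Multiset.erase_cons_tail_of_mem, Multiset.insert_eq_cons]
    all_goals exact Multiset.pair_comm _ _
  · simp [vraw, vsw, Equiv.swap_apply_def, h1, h2]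

theorem rV_vD {n : ℕ} (k : Fin (n - 2)) (b1 b2 : Bool) (v : VC n) :
    uD n (rV v) k (v.1 (idx1 k, b1)) (v.1 (idx2 k, b2)) = rV (vD k b1 b2 v) := by
  apply uraw_inj
  rw [uraw_uD]
  have h0 : uraw n (rV v) = vraw v.1 := rfl
  unfold uswapDest vD
  rw [h0, uswap_vraw]
  split_ifs <;> rfl

theorem QV_lump (n : ℕ) : Lump (QV n) (PUmat n) rV := by
  intro f
  funext v
  rw [QV_act]
  show _ = (PUmat n *ᵥ f) (rV v)
  rw [PU_act]
  congr 1
  rw [Fintype.sum_prod_type]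
  refine Finset.sum_congr rfl fun k _ => ?_
  have h0 : uraw n (rV v) = vraw v.1 := rfl
  rw [h0]
  simp only [vraw, Fintype.sum_prod_type, Multiset.insert_eq_cons, Multiset.map_cons, Multiset.map_singleton,
    Multiset.sum_cons, Multiset.sum_singleton, rV_vD, Fintype.sum_bool, Function.comp]
  ring

theorem PU_sto (n : ℕ) (hn : 4 ≤ n) : Sto (PUmat n) := by
  have hn' : (4:ℝ) ≤ n := by exact_mod_cast hn
  constructor
  · intro x y
    show 0 ≤ PU n x y
    unfold PU
    refine mul_nonneg (by apply div_nonneg <;> linarith) (Finset.sum_nonneg fun k _ => ?_)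
    refine Multiset.sum_nonneg ?_
    intro a ha
    obtain ⟨l1, _, rfl⟩ := Multiset.mem_map.1 ha
    refine Multiset.sum_nonneg ?_
    intro a ha
    obtain ⟨l1, _, rfl⟩ := Multiset.mem_map.1 ha
    split_ifs <;> norm_num
  · intro x
    have : ∑ y, PUmat n x y = (PUmat n *ᵥ (fun _ => 1)) x := by simp [Matrix.mulVec, dotProduct]
    rw [this, PU_act]
    have hc : ∀ k, Multiset.card (uraw n x k) = 2 := x.2.1
    simp [hc]
    rw [Nat.cast_sub (by omega)]
    have : (n:ℝ) - 2 ≠ 0 := by linarith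
    push_cast
    field_simp
    norm_num

theorem fibre_card {n : ℕ} (hn : 4 ≤ n) (T : UCOM n) :
    Fintype.card {v : VC n // rV v = T} = 2 ^ (n - cherries n T - 1) := by
  classical
  have e : {v : VC n // rV v = T} ≃ (∀ k : Fin (n - 1), {p : Fin (n - 1) × Fin (n - 1) //
      ({p.1, p.2} : Multiset (Fin (n - 1))) = uraw n T k}) :=
    { toFun := fun v k => ⟨(v.1.1 (k, false), v.1.1 (k, true)), (congrFun (congrArg (uraw n) v.2) k)⟩
      invFun := fun p => 
        have h : vraw (fun s : Slot n => if s.2 then (p s.1).1.2 else (p s.1).1.1) = uraw n T := by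
          funext k; rw [← (p k).2]; rfl
        ⟨⟨fun s => if s.2 then (p s.1).1.2 else (p s.1).1.1, by rw [h]; exact T.2⟩, uraw_inj h⟩
      left_inv := by
        intro v; apply Subtype.ext; apply Subtype.ext; funext ⟨k, b⟩; cases b <;> rfl
      right_inv := by
        intro p; funext k; apply Subtype.ext; rfl }
  rw [Fintype.card_congr e, Fintype.card_pi]
  have hk : ∀ k : Fin (n - 1), Fintype.card {p : Fin (n - 1) × Fin (n - 1) //
      ({p.1, p.2} : Multiset (Fin (n - 1))) = uraw n T k} =
      if (∀ a ∈ uraw n T k, (a : ℕ) = 0) then 1 else 2 := by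
    intro k
    obtain ⟨a, b, hab⟩ := Multiset.card_eq_two.1 (T.2.1 k)
    have hab' : uraw n T k = {a, b} := hab
    rw [Fintype.card_subtype]
    have hset : (Finset.univ.filter fun p : Fin (n - 1) × Fin (n - 1) =>
      ({p.1, p.2} : Multiset (Fin (n - 1))) = uraw n T k) = {(a, b), (b, a)} := by
      ext ⟨c, d⟩
      simp only [Finset.mem_filter, Finset.mem_univ, true_and, hab', Finset.mem_insert, Finset.mem_singleton, Prod.mk.injEq]
      constructor
      · intro h
        have h1 := congrArg (Multiset.count a) h
        have h2 := congrArg (Multiset.count b) h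
        have h3 := congrArg (Multiset.count c) h
        have h4 := congrArg (Multiset.count d) h
        simp only [Multiset.insert_eq_cons, Multiset.count_cons, Multiset.count_singleton] at h1 h2 h3 h4
        grind
      · rintro (⟨rfl, rfl⟩ | ⟨rfl, rfl⟩)
        · rfl
        · exact Multiset.pair_comm _ _
    rw [hset]
    by_cases hne : a = b
    · subst hne
      have ha : (a : ℕ) = 0 := by
        by_contra h
        have := T.2.2.1 a
        rw [if_neg h] at this
        have h2 := Finset.single_le_sum (f := fun k => Multiset.count a (uraw n T k)) (fun _ _ => Nat.zero_le _) (Finset.mem_univ k)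
        have h3 : Multiset.count a (uraw n T k) = 2 := by rw [hab']; simp
        have h4 : ∑ k, Multiset.count a (uraw n T k) = 1 := this
        simp only [h3, h4] at h2
        omega
      rw [if_pos]
      · simp
      · rw [hab']; simp [ha]
    · rw [if_neg]
      · rw [Finset.card_pair]; simp [Prod.ext_iff, hne]
      · rw [hab']
        intro h
        apply hne
        apply Fin.ext
        rw [h a (by simp), h b (by simp)]
  simp_rw [hk]
  rw [Finset.prod_ite]
  simp only [Finset.prod_const_one, one_mul, Finset.prod_const]
  congr 1
  have := Finset.card_filter_add_card_filter_not (s := (Finset.univ : Finset (Fin (n-1)))) (fun k : Fin (n - 1) => ∀ a ∈ uraw n T k, (a : ℕ) = 0)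
  rw [Finset.card_univ, Fintype.card_fin] at this
  unfold cherries
  omega

theorem tajima_push {n : ℕ} (hn : 4 ≤ n) :
    tajima n = push (rV (n := n)) (fun _ => 1 / ((n - 1).factorial : ℝ)) := by
  funext T
  unfold tajima push
  rw [← Finset.sum_filter, Finset.sum_const, ← Fintype.card_subtype, fibre_card hn]
  simp [div_eq_mul_inv]

theorem QV_stat (n : ℕ) (hn : 4 ≤ n) (c : ℝ) : (fun _ => c) ᵥ* QV n = fun _ => c := by
  have h : QV n *ᵥ ((fun _ => c) ∘ rV) = _ := QV_lump n (fun _ => c)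
  rw [← QV_symm, Matrix.vecMul_transpose]
  refine Eq.trans h ?_
  funext v
  show (PUmat n *ᵥ (fun _ => c)) (rV v) = c
  simp only [Matrix.mulVec, dotProduct]
  rw [← Finset.sum_mul, (PU_sto n hn).one, one_mul]

theorem tajima_stat {n : ℕ} (hn : 4 ≤ n) : tajima n ᵥ* PUmat n = tajima n := by
  rw [tajima_push hn]
  exact (QV_lump n).stat (QV_stat n hn _)
end VPart

section CPart

theorem sdr_count {α : Type*} [Fintype α] [DecidableEq α] (N : ℕ) (S : Fin N → Finset α)
    (hS : ∀ i j : Fin N, i ≤ j → S j ⊆ S i) :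
    (Finset.univ.filter fun g : Fin N → α => Function.Injective g ∧ ∀ j, g j ∈ S j).card
      = ∏ j : Fin N, ((S j).card - (N - 1 - j)) := by
  induction N with
  | zero =>
    simp [Function.injective_of_subsingleton]
  | succ N ih =>
    have ih' := ih (fun j => S j.succ) (fun i j h => hS _ _ (Fin.succ_le_succ_iff.2 h))
    rw [Fin.prod_univ_succ]
    have e : ∏ i : Fin N, ((S i.succ).card - (N + 1 - 1 - (i.succ : ℕ))) =
        ∏ i : Fin N, ((S i.succ).card - (N - 1 - (i : ℕ))) := by
      refine Finset.prod_congr rfl fun i _ => ?_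
      have := i.2
      rw [Fin.val_succ]; congr 1; omega
    rw [e, ← ih', mul_comm, ← smul_eq_mul]
    have hmap : ∀ g ∈ (Finset.univ.filter fun g : Fin (N+1) → α => Function.Injective g ∧ ∀ j, g j ∈ S j),
        Fin.tail g ∈ (Finset.univ.filter fun g : Fin N → α => Function.Injective g ∧ ∀ j, g j ∈ S j.succ) := by
      intro g hg
      simp only [Finset.mem_filter, Finset.mem_univ, true_and] at hg ⊢
      exact ⟨fun a b h => Fin.succ_injective _ (hg.1 h), fun j => hg.2 _⟩
    rw [Finset.card_eq_sum_card_fiberwise hmap, ← Finset.sum_const]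
    refine Finset.sum_congr rfl fun g hg => ?_
    simp only [Finset.mem_filter, Finset.mem_univ, true_and] at hg
    have hcard : (S 0 \ Finset.univ.image g).card = (S 0).card - (N + 1 - 1 - ((0 : Fin (N+1)) : ℕ)) := by
      rw [Finset.card_sdiff_of_subset, Finset.card_image_of_injective _ hg.1]
      · simp
      · intro a ha
        obtain ⟨j, _, rfl⟩ := Finset.mem_image.1 ha
        exact hS 0 j.succ (Fin.zero_le _) (hg.2 j)
    rw [← hcard]
    symm
    refine Finset.card_bij (fun a _ => (Fin.cons a g : Fin (N+1) → α)) ?_ ?_ ?_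
    · intro a ha
      simp only [Finset.mem_sdiff, Finset.mem_image, Finset.mem_univ, true_and, not_exists] at ha
      simp only [Finset.mem_filter, Finset.mem_univ, true_and, Fin.tail_cons, and_true]
      refine ⟨Fin.cons_injective_iff.2 ⟨?_, hg.1⟩, ?_⟩
      · rintro ⟨j, hj⟩; exact ha.2 j hj
      · intro j
        refine Fin.cases ?_ (fun i => ?_) j
        · exact ha.1
        · exact hg.2 i
    · intro a _ b _ h
      exact congrFun h 0
    · intro f hf
      simp only [Finset.mem_filter, Finset.mem_univ, true_and] at hf
      obtain ⟨⟨hinj, hm⟩, rfl⟩ := hf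
      refine ⟨f 0, ?_, Fin.cons_self_tail f⟩
      simp only [Finset.mem_sdiff, Finset.mem_image, Finset.mem_univ, true_and, not_exists]
      exact ⟨hm 0, fun j hj => (Fin.succ_ne_zero j) (hinj hj)⟩

theorem sdr_marg {α : Type*} [Fintype α] [DecidableEq α] (N : ℕ) (S : Fin N → Finset α)
    (hS : ∀ i j : Fin N, i ≤ j → S j ⊆ S i) (j0 : Fin N) (hj0 : (j0 : ℕ) = 0) (s : α) (hs : s ∈ S j0)
    (c : ℕ → ℕ) (hc : ∀ j : Fin N, (S j \ {s}).card = c j) :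
    (Finset.univ.filter fun g : Fin N → α => (Function.Injective g ∧ ∀ j, g j ∈ S j) ∧ g j0 = s).card
      = ∏ i ∈ Finset.range (N - 1), (c (i + 1) - (N - 2 - i)) := by
  cases N with
  | zero => exact j0.elim0
  | succ N =>
    have h0 : j0 = 0 := Fin.ext hj0
    subst h0
    have h := sdr_count N (fun j => S j.succ \ {s})
      (fun i j h => Finset.sdiff_subset_sdiff (hS _ _ (Fin.succ_le_succ_iff.2 h)) subset_rfl)
    have e : ∏ i ∈ Finset.range (N + 1 - 1), (c (i + 1) - (N + 1 - 2 - i)) =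
        ∏ j : Fin N, ((S j.succ \ {s}).card - (N - 1 - j)) := by
      rw [Nat.add_sub_cancel, Finset.prod_range]
      refine Finset.prod_congr rfl fun i _ => ?_
      rw [hc, Fin.val_succ]; rfl
    rw [e, ← h]
    symm
    refine Finset.card_bij (fun g _ => (Fin.cons s g : Fin (N+1) → α)) ?_ ?_ ?_
    · intro g hg
      simp only [Finset.mem_filter, Finset.mem_univ, true_and, Finset.mem_sdiff, Finset.mem_singleton] at hg ⊢
      refine ⟨⟨Fin.cons_injective_iff.2 ⟨?_, hg.1⟩, ?_⟩, rfl⟩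
      · rintro ⟨j, hj⟩; exact (hg.2 j).2 hj
      · intro j
        refine Fin.cases ?_ (fun i => ?_) j
        · exact hs
        · exact (hg.2 i).1
    · intro a _ b _ h
      exact (Fin.cons_injective2 h).2
    · intro f hf
      simp only [Finset.mem_filter, Finset.mem_univ, true_and] at hf
      obtain ⟨⟨hinj, hm⟩, rfl⟩ := hf
      refine ⟨Fin.tail f, ?_, Fin.cons_self_tail f⟩
      simp only [Finset.mem_filter, Finset.mem_univ, true_and, Finset.mem_sdiff, Finset.mem_singleton]
      refine ⟨fun a b h => Fin.succ_injective _ (hinj h), fun j => ⟨hm _, fun hj => (Fin.succ_ne_zero j) (hinj hj)⟩⟩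

theorem prodl (M k : ℕ) (h1 : 1 ≤ k) (h2 : k ≤ M + 1) :
    ∏ i ∈ Finset.range M, (2 * (M - i) - (if i + 2 ≤ k then 1 else 0) - (M - 1 - i))
      = M.factorial * (M + 2 - k) := by
  induction M generalizing k with
  | zero => have : k = 1 := by omega
            subst this; simp
  | succ M ih =>
    rw [Finset.prod_range_succ']
    by_cases hk : k = 1
    · subst hk
      have := ih 1 le_rfl (by omega)
      rw [Finset.prod_congr rfl (g := fun i => (2 * (M - i) - (if i + 2 ≤ 1 then 1 else 0) - (M - 1 - i))), this, Nat.factorial_succ]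
      · have e1 : 2 * (M + 1 - 0) - (if 0 + 2 ≤ 1 then 1 else 0) - (M + 1 - 1 - 0) = M + 2 := by
          simp; omega
        rw [e1, show M + 2 - 1 = M + 1 by omega, show M + 1 + 2 - 1 = M + 2 by omega]; ring
      · intro i hi
        rw [if_neg (by omega), if_neg (by omega)]
        have := Finset.mem_range.1 hi
        omega
    · have := ih (k - 1) (by omega) (by omega)
      rw [Finset.prod_congr rfl (g := fun i => (2 * (M - i) - (if i + 2 ≤ k - 1 then 1 else 0) - (M - 1 - i))), this, Nat.factorial_succ]
      · have e1 : 2 * (M + 1 - 0) - (if 0 + 2 ≤ k then 1 else 0) - (M + 1 - 1 - 0) = M + 1 := by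
          rw [if_pos (by omega)]; omega
        rw [e1, show M + 2 - (k - 1) = M + 1 + 2 - k by omega]; ring
      · intro i hi
        have := Finset.mem_range.1 hi
        split_ifs <;> omega

theorem count_vraw {n : ℕ} (w : Slot n → Fin (n - 1)) (a : Fin (n - 1)) :
    ∑ k, (vraw w k).count a = (Finset.univ.filter fun s => w s = a).card := by
  rw [Finset.card_filter, Fintype.sum_prod_type]
  refine Finset.sum_congr rfl fun k _ => ?_
  simp only [vraw, Multiset.insert_eq_cons, Multiset.count_cons, Multiset.count_singleton, Fintype.sum_bool, eq_comm]

theorem valid_iff {n : ℕ} (hn : 4 ≤ n) (w : Slot n → Fin (n - 1)) :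
    IsUCOMraw n (vraw w) ↔ (∀ a : Fin (n - 1), (a : ℕ) ≠ 0 → (Finset.univ.filter fun s => w s = a).card = 1) ∧
      ∀ s, (w s : ℕ) ≠ 0 → (w s : ℕ) ≤ s.1 := by
  unfold IsUCOMraw
  simp_rw [count_vraw]
  constructor
  · rintro ⟨_, h2, h3⟩
    refine ⟨fun a ha => by rw [h2, if_neg ha], fun s hs => h3 _ _ hs ?_⟩
    obtain ⟨k, b⟩ := s
    cases b <;> simp [vraw]
  · rintro ⟨h1, h2⟩
    refine ⟨fun k => by simp [vraw], fun a => ?_, ?_⟩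
    · split_ifs with ha
      · have ht := Finset.card_eq_sum_card_fiberwise (s := (Finset.univ : Finset (Slot n)))
          (t := Finset.univ) (f := w) (fun _ _ => by simp)
        rw [← Finset.add_sum_erase _ _ (Finset.mem_univ a), Finset.sum_congr rfl (g := fun _ => 1) (by
          intro b hb
          apply h1
          intro hb0
          exact (Finset.mem_erase.1 hb).1 (Fin.ext (by omega)))] at ht
        simp at ht
        omega
      · exact h1 a ha
    · intro j k hj hk
      have : ∃ b, j = w (k, b) := by
        simp only [vraw, Multiset.insert_eq_cons, Multiset.mem_cons, Multiset.mem_singleton] at hk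
        rcases hk with h | h
        · exact ⟨_, h⟩
        · exact ⟨_, h⟩
      obtain ⟨b, rfl⟩ := this
      exact h2 _ hj

def oneF {n : ℕ} (hn : 4 ≤ n) : Fin (n - 1) := ⟨1, by omega⟩

theorem exists_idx2 {n : ℕ} (a : Fin (n - 1)) (ha : (a : ℕ) ≠ 0) : ∃ j : Fin (n - 2), a = idx2 j :=
  ⟨⟨a - 1, by omega⟩, Fin.ext (by simp [idx2]; omega)⟩

theorem idx2_inj {n : ℕ} : Function.Injective (idx2 (n := n)) := by
  intro a b h
  have := congrArg Fin.val h
  simp only [idx2] at this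
  exact Fin.ext (by omega)

theorem marg_count {n : ℕ} (hn : 4 ≤ n) (s : Slot n) :
    (Finset.univ.filter fun v : VC n => v.1 s = oneF hn).card =
      if (s.1 : ℕ) = 0 then 0 else (n - 3).factorial * (n - 1 - s.1) := by
  split_ifs with hk
  · rw [Finset.card_eq_zero, Finset.filter_eq_empty_iff]
    intro v _ h
    have := ((valid_iff hn v.1).1 v.2).2 s (by rw [h]; simp [oneF])
    rw [h, hk] at this
    simp [oneF] at this
  · have hk2 := s.1.2
    have h := sdr_marg (n - 2) (fun j : Fin (n - 2) => (Finset.Ici (idx2 j)) ×ˢ (Finset.univ : Finset Bool))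
      (fun i j hij => Finset.product_subset_product (Finset.Ici_subset_Ici.2 (by
        simp only [idx2, Fin.mk_le_mk]; have : (i:ℕ) ≤ j := hij; omega)) subset_rfl)
      ⟨0, by omega⟩ rfl s (by simp [idx2, Fin.le_def]; omega)
      (fun j => 2 * (n - 2 - j) - (if j + 1 ≤ s.1 then 1 else 0)) (by
        intro j
        have hc : ((Finset.Ici (idx2 j)) ×ˢ (Finset.univ : Finset Bool)).card = 2 * (n - 2 - j) := by
          rw [Finset.card_product, Fin.card_Ici]; simp [idx2]; omega
        by_cases hj : (j:ℕ) + 1 ≤ s.1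
        · rw [Finset.card_sdiff_of_subset, hc, if_pos hj]; · simp
          simp [idx2, Fin.le_def, hj]
        · rw [Finset.sdiff_singleton_eq_erase, Finset.erase_eq_of_notMem, hc, if_neg hj]; · simp
          simp [idx2, Fin.le_def]; omega)
    have hp := prodl (n - 3) s.1 (by omega) (by omega)
    rw [show n - 3 + 2 - (s.1 : ℕ) = n - 1 - s.1 by omega] at hp
    rw [← hp, show n - 3 = n - 2 - 1 by omega]
    rw [Finset.prod_congr rfl (g := fun i => (2 * (n - 2 - (i + 1)) - if i + 1 + 1 ≤ (s.1:ℕ) then 1 else 0) - (n - 2 - 2 - i)) (by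
      intro i _
      congr 1
      congr 1
      omega), ← h]
    symm
    obtain ⟨z, hz⟩ : ∃ z : Fin (n - 1), (z : ℕ) = 0 := ⟨⟨0, by omega⟩, rfl⟩
    have hw : ∀ (g : Fin (n - 2) → Slot n) (hg : Function.Injective g ∧ ∀ j, g j ∈ (Finset.Ici (idx2 j)) ×ˢ (Finset.univ : Finset Bool)),
        IsUCOMraw n (vraw (Function.extend g idx2 (fun _ => z))) := by
      intro g hg
      rw [valid_iff hn]
      have hiff : ∀ s j, Function.extend g idx2 (fun _ => z) s = idx2 j ↔ s = g j := by
        intro s j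
        by_cases hs : ∃ i, g i = s
        · obtain ⟨i, rfl⟩ := hs
          rw [hg.1.extend_apply]
          exact ⟨fun h => by rw [idx2_inj h], fun h => by rw [hg.1 h]⟩
        · rw [Function.extend_apply' _ _ _ hs]
          constructor
          · intro h; have := congrArg Fin.val h; simp [idx2, hz] at this
          · intro h; exact absurd ⟨j, h.symm⟩ hs
      constructor
      · intro a ha
        obtain ⟨j, rfl⟩ := exists_idx2 a ha
        rw [Finset.card_eq_one]
        refine ⟨g j, ?_⟩
        ext t
        rw [Finset.mem_filter, hiff]; simp
      · intro t ht
        obtain ⟨j, hj⟩ := exists_idx2 _ ht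
        rw [hj]
        rw [hiff] at hj
        rw [hj]
        have := hg.2 j
        simp only [Finset.mem_product, Finset.mem_Ici, Finset.mem_univ, and_true] at this
        exact this
    refine Finset.card_bij (fun g hg => ⟨Function.extend g idx2 (fun _ => z), hw g (Finset.mem_filter.1 hg).2.1⟩) ?_ ?_ ?_
    · intro g hg
      simp only [Finset.mem_filter, Finset.mem_univ, true_and] at hg ⊢
      rw [← hg.2, hg.1.1.extend_apply]; rfl
    · intro g hg g' hg' h
      simp only [Finset.mem_filter, Finset.mem_univ, true_and] at hg hg'
      have h := congrArg Subtype.val h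
      funext j
      have h2 := congrFun h (g j)
      simp only [hg.1.1.extend_apply] at h2
      by_cases hs : ∃ i, g' i = g j
      · obtain ⟨i, hi⟩ := hs
        rw [← hi, hg'.1.1.extend_apply] at h2
        rw [← hi, idx2_inj h2]
      · rw [Function.extend_apply' _ _ _ hs] at h2
        have := congrArg Fin.val h2; simp [idx2, hz] at this
    · intro v hv
      simp only [Finset.mem_filter, Finset.mem_univ, true_and] at hv
      obtain ⟨hv1, hv2⟩ := (valid_iff hn v.1).1 v.2
      have hex : ∀ j : Fin (n - 2), ∃ t, v.1 t = idx2 j ∧ ∀ t', v.1 t' = idx2 j → t' = t := by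
        intro j
        obtain ⟨t, ht⟩ := Finset.card_eq_one.1 (hv1 (idx2 j) (by simp [idx2]))
        refine ⟨t, ?_, ?_⟩
        · have : t ∈ (Finset.univ.filter fun s => v.1 s = idx2 j) := by rw [ht]; simp
          simpa using this
        · intro t' ht'
          have : t' ∈ (Finset.univ.filter fun s => v.1 s = idx2 j) := by simpa using ht'
          rw [ht] at this; simpa using this
      choose g hg1 hg2 using hex
      have hinj : Function.Injective g := by
        intro a b hab
        apply idx2_inj
        rw [← hg1 a, ← hg1 b, hab]
      refine ⟨g, ?_, ?_⟩
      · simp only [Finset.mem_filter, Finset.mem_univ, true_and, Finset.mem_product, Finset.mem_Ici, and_true]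
        refine ⟨⟨hinj, fun j => ?_⟩, ?_⟩
        · have := hv2 (g j) (by rw [hg1]; simp [idx2])
          rw [hg1] at this; exact this
        · exact (hg2 ⟨0, by omega⟩ s (hv.trans rfl)).symm
      · apply Subtype.ext
        funext t
        by_cases hs : ∃ i, g i = t
        · obtain ⟨i, rfl⟩ := hs
          show Function.extend g idx2 (fun _ => z) (g i) = _
          rw [hinj.extend_apply, hg1]
        · show Function.extend g idx2 (fun _ => z) t = _
          rw [Function.extend_apply' _ _ _ hs]
          by_contra hne
          have : (v.1 t : ℕ) ≠ 0 := fun h0 => hne (Fin.ext (by rw [hz, h0]))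
          obtain ⟨j, hj⟩ := exists_idx2 _ this
          exact hs ⟨j, (hg2 j t hj).symm⟩
end CPart

section MPart
open Matrix

noncomputable def fU {n : ℕ} (hn : 4 ≤ n) (T : UCOM n) : ℝ :=
  ∑ k : Fin (n - 1), (k : ℝ) * ((uraw n T k).count (oneF hn) : ℝ)

theorem exists_slot {n : ℕ} (hn : 4 ≤ n) (v : VC n) : ∃ t, ∀ s, v.1 s = oneF hn ↔ s = t := by
  obtain ⟨t, ht⟩ := Finset.card_eq_one.1 (((valid_iff hn v.1).1 v.2).1 (oneF hn) (by simp [oneF]))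
  refine ⟨t, fun s => ?_⟩
  have : s ∈ (Finset.univ.filter fun s => v.1 s = oneF hn) ↔ s ∈ ({t} : Finset (Slot n)) := by rw [ht]
  simpa using this

theorem fU_rV {n : ℕ} (hn : 4 ≤ n) (v : VC n) :
    fU hn (rV v) = ∑ s : Slot n, (s.1 : ℝ) * (if v.1 s = oneF hn then 1 else 0) := by
  rw [Fintype.sum_prod_type]
  unfold fU
  refine Finset.sum_congr rfl fun k _ => ?_
  have h0 : uraw n (rV v) = vraw v.1 := rfl
  rw [h0]
  simp only [vraw, Multiset.insert_eq_cons, Multiset.count_cons, Multiset.count_singleton, Fintype.sum_bool, eq_comm (a := oneF hn)]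
  push_cast
  ring

theorem fU_slot {n : ℕ} (hn : 4 ≤ n) (v : VC n) (t : Slot n) (ht : ∀ s, v.1 s = oneF hn ↔ s = t) :
    fU hn (rV v) = t.1 := by
  rw [fU_rV]
  simp [ht]

theorem moment {n : ℕ} (hn : 4 ≤ n) (h : ℕ → ℝ) :
    ∑ v : VC n, ∑ s : Slot n, h s.1 * (if v.1 s = oneF hn then 1 else 0) =
      2 * ((n - 3).factorial : ℝ) * ∑ k ∈ Finset.range (n - 1), h k * (if k = 0 then 0 else ((n : ℝ) - 1 - k)) := by
  rw [Finset.sum_comm]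
  simp_rw [← Finset.mul_sum]
  have : ∀ s : Slot n, (∑ v : VC n, if v.1 s = oneF hn then (1:ℝ) else 0) =
      ((n - 3).factorial : ℝ) * (if (s.1 : ℕ) = 0 then 0 else ((n : ℝ) - 1 - (s.1 : ℕ))) := by
    intro s
    rw [Finset.sum_boole, marg_count hn s]
    split_ifs
    · simp
    · have := s.1.2
      rw [Nat.cast_mul, Nat.cast_sub (by omega), Nat.cast_sub (by omega)]; simp
  simp_rw [this]
  rw [Fintype.sum_prod_type, Finset.sum_range, Finset.mul_sum]
  refine Finset.sum_congr rfl fun k _ => ?_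
  simp only [Fintype.sum_bool]
  ring

theorem psum1 (m : ℕ) : ∑ k ∈ Finset.range (m + 1), (k : ℝ) = m * (m + 1) / 2 := by
  induction m with
  | zero => simp
  | succ m ih => rw [Finset.sum_range_succ, ih]; push_cast; ring
theorem psum2 (m : ℕ) : ∑ k ∈ Finset.range (m + 1), (k : ℝ) ^ 2 = m * (m + 1) * (2 * m + 1) / 6 := by
  induction m with
  | zero => simp
  | succ m ih => rw [Finset.sum_range_succ, ih]; push_cast; ring
theorem psum3 (m : ℕ) : ∑ k ∈ Finset.range (m + 1), (k : ℝ) ^ 3 = (m * (m + 1) / 2) ^ 2 := by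
  induction m with
  | zero => simp
  | succ m ih => rw [Finset.sum_range_succ, ih]; push_cast; ring

theorem moments {n : ℕ} (hn : 4 ≤ n) :
    (Fintype.card (VC n) : ℝ) = ((n - 3).factorial : ℝ) * ((n - 2) * (n - 1)) ∧
    ∑ v : VC n, fU hn (rV v) = ((n - 3).factorial : ℝ) * ((n - 2) * (n - 1)) * (n / 3) ∧
    ∑ v : VC n, (fU hn (rV v)) ^ 2 = ((n - 3).factorial : ℝ) * ((n - 2) * (n - 1)) * ((n - 1) * n / 6) := by
  obtain ⟨m, hm⟩ : ∃ m, n - 1 = m + 1 := ⟨n - 2, by omega⟩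
  have hnm : (n : ℝ) = m + 2 := by
    have : n = m + 2 := by omega
    rw [this]; push_cast; ring
  have e0 := moment hn (fun _ => 1)
  have e1 := moment hn (fun k => (k : ℝ))
  have e2 := moment hn (fun k => (k : ℝ) ^ 2)
  have l0 : ∀ v : VC n, ∑ s : Slot n, (1:ℝ) * (if v.1 s = oneF hn then 1 else 0) = 1 := by
    intro v
    obtain ⟨t, ht⟩ := exists_slot hn v
    simp [ht]
  have l2 : ∀ v : VC n, ∑ s : Slot n, (s.1 : ℝ) ^ 2 * (if v.1 s = oneF hn then 1 else 0) = (fU hn (rV v)) ^ 2 := by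
    intro v
    obtain ⟨t, ht⟩ := exists_slot hn v
    rw [fU_slot hn v t ht]
    simp [ht]
  simp only [l0] at e0
  simp only [← fU_rV] at e1
  simp only [l2] at e2
  have hr : Finset.range (n - 1) = Finset.range (m + 1) := by rw [hm]
  rw [hr] at e0 e1 e2
  refine ⟨?_, ?_, ?_⟩
  · have : ∑ k ∈ Finset.range (m + 1), (1:ℝ) * (if k = 0 then 0 else ((n : ℝ) - 1 - k)) =
        ∑ k ∈ Finset.range (m + 1), ((n : ℝ) - 1 - k) - ((n:ℝ) - 1) := by
      rw [Finset.sum_range_succ', Finset.sum_range_succ']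
      simp
    rw [this, Finset.sum_sub_distrib, psum1] at e0
    simp at e0
    rw [e0, hnm]
    ring
  · rw [e1, Finset.sum_congr rfl (g := fun k : ℕ => ((n:ℝ) - 1) * k - (k:ℝ) ^ 2) (by
      intro k _; split_ifs with hk
      · simp [hk]
      · ring), Finset.sum_sub_distrib, ← Finset.mul_sum, psum1, psum2, hnm]
    ring
  · rw [e2, Finset.sum_congr rfl (g := fun k : ℕ => ((n:ℝ) - 1) * (k:ℝ) ^ 2 - (k:ℝ) ^ 3) (by
      intro k _; split_ifs with hk
      · simp [hk]
      · ring), Finset.sum_sub_distrib, ← Finset.mul_sum, psum2, psum3, hnm]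
    ring

theorem card_VC {n : ℕ} (hn : 4 ≤ n) : (Fintype.card (VC n) : ℝ) = ((n - 1).factorial : ℝ) := by
  rw [(moments hn).1]
  obtain ⟨m, rfl⟩ : ∃ m, n = m + 3 := ⟨n - 3, by omega⟩
  rw [show m + 3 - 1 = m + 1 + 1 by omega, Nat.factorial_succ, Nat.factorial_succ, Nat.add_sub_cancel]
  push_cast
  ring

theorem tajima_sum {n : ℕ} (hn : 4 ≤ n) : ∑ T, tajima n T = 1 := by
  have := push_sum (rV (n := n)) (fun _ => 1 / ((n - 1).factorial : ℝ)) (fun _ => 1)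
  rw [← tajima_push hn] at this
  simp only [mul_one, Finset.sum_const, Finset.card_univ, nsmul_eq_mul] at this
  rw [this, card_VC hn]
  have : ((n - 1).factorial : ℝ) ≠ 0 := by positivity
  field_simp

noncomputable def gU {n : ℕ} (hn : 4 ≤ n) (T : UCOM n) : ℝ := fU hn T - n / 3

theorem gU_mean {n : ℕ} (hn : 4 ≤ n) : ∑ T, tajima n T * gU hn T = 0 := by
  rw [tajima_push hn, push_sum, ← Finset.mul_sum]
  unfold gU
  rw [Finset.sum_sub_distrib, (moments hn).2.1, Finset.sum_const, Finset.card_univ, nsmul_eq_mul, (moments hn).1]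
  ring

theorem gU_var {n : ℕ} (hn : 4 ≤ n) :
    (gU hn ∘ rV) ⬝ᵥ (gU hn ∘ rV) = (Fintype.card (VC n) : ℝ) * (n * (n - 3) / 18) := by
  have : (gU hn ∘ rV) ⬝ᵥ (gU hn ∘ rV) = ∑ v : VC n, ((fU hn (rV v)) ^ 2 - (2 * n / 3) * fU hn (rV v) + n ^ 2 / 9) := by
    refine Finset.sum_congr rfl fun v _ => ?_
    simp only [Function.comp, gU]; ring
  rw [this, Finset.sum_add_distrib, Finset.sum_sub_distrib, ← Finset.mul_sum, (moments hn).2.1, (moments hn).2.2,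
    Finset.sum_const, Finset.card_univ, nsmul_eq_mul, (moments hn).1]
  ring

theorem diff_sq {n : ℕ} (hn : 4 ≤ n) (v : VC n) (t : Slot n) (ht : ∀ s, v.1 s = oneF hn ↔ s = t)
    (k : Fin (n - 2)) (b1 b2 : Bool) :
    (gU hn (rV v) - gU hn (rV (vD k b1 b2 v))) ^ 2 ≤
      (if (idx1 k, b1) = t then 1 else 0) + (if (idx2 k, b2) = t then 1 else 0) := by
  have hpos : (0:ℝ) ≤ (if (idx1 k, b1) = t then 1 else 0) + (if (idx2 k, b2) = t then 1 else 0) := by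
    split_ifs <;> norm_num
  unfold gU
  by_cases h : IsUCOMraw n (vraw (v.1 ∘ vsw k b1 b2))
  · have e : vD k b1 b2 v = ⟨_, h⟩ := dif_pos h
    rw [e, fU_slot hn v t ht, fU_slot hn ⟨_, h⟩ (vsw k b1 b2 t) (by
      intro s
      show v.1 (vsw k b1 b2 s) = _ ↔ _
      rw [ht, vsw, Equiv.swap_apply_eq_iff])]
    unfold vsw
    by_cases h1 : (idx1 k, b1) = t
    · rw [if_pos h1, ← h1, Equiv.swap_apply_left]
      simp [idx1, idx2]
    · by_cases h2 : (idx2 k, b2) = t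
      · rw [if_neg h1, if_pos h2, ← h2, Equiv.swap_apply_right]
        simp [idx1, idx2]
      · rw [Equiv.swap_apply_of_ne_of_ne (Ne.symm h1) (Ne.symm h2)]
        simpa using hpos
  · have e : vD k b1 b2 v = v := dif_neg h
    rw [e]
    simpa using hpos

theorem diff_total {n : ℕ} (hn : 4 ≤ n) (v : VC n) :
    ∑ p : Fin (n - 2) × Bool × Bool, (gU hn (rV v) - gU hn (rV (vD p.1 p.2.1 p.2.2 v))) ^ 2 ≤ 4 := by
  obtain ⟨t, ht⟩ := exists_slot hn v
  refine (Finset.sum_le_sum fun p _ => diff_sq hn v t ht p.1 p.2.1 p.2.2).trans ?_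
  rw [Finset.sum_add_distrib, Finset.sum_boole, Finset.sum_boole]
  have h1 : (Finset.univ.filter fun p : Fin (n - 2) × Bool × Bool => (idx1 p.1, p.2.1) = t).card ≤ 2 := by
    have := Finset.card_le_card_of_injOn (s := Finset.univ.filter fun p : Fin (n - 2) × Bool × Bool => (idx1 p.1, p.2.1) = t)
      (t := (Finset.univ : Finset Bool)) (fun p => p.2.2) (fun _ _ => by simp) (by
        rintro ⟨k, b1, b2⟩ hp ⟨k', b1', b2'⟩ hp' he
        simp at hp hp' he
        rw [← hp'] at hp
        simp [idx1] at hp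
        ext1
        · exact Fin.ext hp.1
        · simp [hp.2, he])
    simpa using this
  have h2 : (Finset.univ.filter fun p : Fin (n - 2) × Bool × Bool => (idx2 p.1, p.2.2) = t).card ≤ 2 := by
    have := Finset.card_le_card_of_injOn (s := Finset.univ.filter fun p : Fin (n - 2) × Bool × Bool => (idx2 p.1, p.2.2) = t)
      (t := (Finset.univ : Finset Bool)) (fun p => p.2.1) (fun _ _ => by simp) (by
        rintro ⟨k, b1, b2⟩ hp ⟨k', b1', b2'⟩ hp' he
        simp at hp hp' he
        rw [← hp'] at hp
        simp [idx2] at hp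
        ext1
        · exact Fin.ext hp.1
        · simp [hp.2, he])
    simpa using this
  have h3 : ((Finset.univ.filter fun p : Fin (n - 2) × Bool × Bool => (idx1 p.1, p.2.1) = t).card : ℝ) ≤ 2 := by exact_mod_cast h1
  have h4 : ((Finset.univ.filter fun p : Fin (n - 2) × Bool × Bool => (idx2 p.1, p.2.2) = t).card : ℝ) ≤ 2 := by exact_mod_cast h2
  linarith

theorem dirichlet {n : ℕ} (hn : 4 ≤ n) :
    (gU hn ∘ rV) ⬝ᵥ (gU hn ∘ rV) - (gU hn ∘ rV) ⬝ᵥ (QV n *ᵥ (gU hn ∘ rV)) ≤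
      (Fintype.card (VC n) : ℝ) / (2 * ((n:ℝ) - 2)) := by
  have hn' : (4:ℝ) ≤ n := by exact_mod_cast hn
  have hn2 : (n:ℝ) - 2 ≠ 0 := by linarith
  set G : VC n → ℝ := gU hn ∘ rV with hG
  have hinv : ∀ p : Fin (n - 2) × Bool × Bool, ∑ v, G (vD p.1 p.2.1 p.2.2 v) ^ 2 = ∑ v, G v ^ 2 := fun p =>
    Equiv.sum_comp (vD_invol p.1 p.2.1 p.2.2).toPerm (fun v => G v ^ 2)
  have hp : ∀ p : Fin (n - 2) × Bool × Bool, ∑ v, G v * G (vD p.1 p.2.1 p.2.2 v) =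
      ∑ v, G v ^ 2 - (1 / 2) * ∑ v, (G v - G (vD p.1 p.2.1 p.2.2 v)) ^ 2 := by
    intro p
    have : ∑ v, (G v - G (vD p.1 p.2.1 p.2.2 v)) ^ 2 = ∑ v, G v ^ 2 - 2 * ∑ v, G v * G (vD p.1 p.2.1 p.2.2 v)
        + ∑ v, G (vD p.1 p.2.1 p.2.2 v) ^ 2 := by
      rw [Finset.mul_sum, ← Finset.sum_sub_distrib, ← Finset.sum_add_distrib]
      exact Finset.sum_congr rfl fun v _ => by ring
    rw [this, hinv]; ring
  have e1 : G ⬝ᵥ (QV n *ᵥ G) = (1 / ((n:ℝ) - 2)) * (1 / 4) * ∑ p : Fin (n - 2) × Bool × Bool, ∑ v, G v * G (vD p.1 p.2.1 p.2.2 v) := by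
    simp only [dotProduct, QV_act]
    rw [Finset.sum_comm, Finset.mul_sum]
    refine Finset.sum_congr rfl fun v _ => ?_
    rw [← Finset.mul_sum, ← Finset.mul_sum]
    ring
  have e2 : G ⬝ᵥ G = ∑ v, G v ^ 2 := Finset.sum_congr rfl fun v _ => by ring
  have hsw : ∑ p : Fin (n - 2) × Bool × Bool, ∑ v : VC n, (G v - G (vD p.1 p.2.1 p.2.2 v)) ^ 2 =
      ∑ v : VC n, ∑ p : Fin (n - 2) × Bool × Bool, (G v - G (vD p.1 p.2.1 p.2.2 v)) ^ 2 := Finset.sum_comm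
  rw [e1, e2]
  simp_rw [hp]
  rw [Finset.sum_sub_distrib, Finset.sum_const, Finset.card_univ, ← Finset.mul_sum, hsw]
  have hc : (Fintype.card (Fin (n - 2) × Bool × Bool) : ℝ) = 4 * ((n:ℝ) - 2) := by
    simp [Nat.cast_sub (show 2 ≤ n by omega)]; ring
  have hb : ∑ v, ∑ p : Fin (n - 2) × Bool × Bool, (G v - G (vD p.1 p.2.1 p.2.2 v)) ^ 2 ≤ (Fintype.card (VC n) : ℝ) * 4 := by
    have := Finset.sum_le_card_nsmul Finset.univ (fun v => ∑ p : Fin (n - 2) × Bool × Bool, (G v - G (vD p.1 p.2.1 p.2.2 v)) ^ 2) 4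
      (fun v _ => diff_total hn v)
    simpa using this
  rw [nsmul_eq_mul, hc]
  set X := ∑ v, ∑ p : Fin (n - 2) × Bool × Bool, (G v - G (vD p.1 p.2.1 p.2.2 v)) ^ 2
  have : ∑ v, G v ^ 2 - 1 / ((n:ℝ) - 2) * (1 / 4) * (4 * ((n:ℝ) - 2) * ∑ v, G v ^ 2 - 1 / 2 * X) = X / (8 * ((n:ℝ) - 2)) := by
    field_simp; ring
  rw [this, div_le_div_iff₀ (by linarith) (by linarith)]
  nlinarith

theorem tU_bound {n : ℕ} (hn : 4 ≤ n) (hD : Doeb (PUmat n)) :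
    1 ≤ tU n ∧ (tU n : ℝ) ≥ ((2 / 90 : ℝ) * ((n : ℝ) * ((n : ℝ) + 1) * ((n : ℝ) - 3)) - 1) * Real.log 2 := by
  have hn' : (4:ℝ) ≤ n := by exact_mod_cast hn
  have hcard : (0:ℝ) < Fintype.card (VC n) := by rw [card_VC hn]; positivity
  have hF : 0 < (gU hn ∘ rV (n := n)) ⬝ᵥ (gU hn ∘ rV) := by
    rw [gU_var]
    have : (0:ℝ) < n - 3 := by linarith
    positivity
  obtain ⟨h1, h2⟩ := lower (QV_lump n) (QV_symm n) (PU_sto n hn) hD (tajima_stat hn) (tajima_sum hn) (gU_mean hn) hF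
  refine ⟨h1, ?_⟩
  have hlog : 0 < Real.log 2 := Real.log_pos (by norm_num)
  by_cases h4 : n = 4
  · subst h4
    have : (0:ℝ) ≤ tU 4 := by positivity
    norm_num
    nlinarith
  · have h5 : (5:ℝ) ≤ n := by exact_mod_cast (show 5 ≤ n by omega)
    have hd : (9:ℝ) < n * (n - 2) * (n - 3) := by
      obtain ⟨m, hm⟩ : ∃ m : ℝ, (n:ℝ) = m + 5 := ⟨n - 5, by ring⟩
      have : 0 ≤ m := by linarith
      rw [hm]; ring_nf; nlinarith [pow_nonneg this 2, pow_nonneg this 3]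
    have hd0 : (0:ℝ) < n * (n - 2) * (n - 3) := by linarith
    have hb := final_bound (T := tU n) (ρ := 9 / (n * (n - 2) * (n - 3))) (by positivity) (by rw [div_lt_one hd0]; exact hd) (by
      apply h2
      · rw [sub_pos, div_lt_one hd0]; exact hd
      · have hd := dirichlet hn
        have : 9 / ((n:ℝ) * (n - 2) * (n - 3)) * ((gU hn ∘ rV (n := n)) ⬝ᵥ (gU hn ∘ rV)) = (Fintype.card (VC n) : ℝ) / (2 * ((n:ℝ) - 2)) := by
          rw [gU_var]
          have a1 : (n:ℝ) - 2 ≠ 0 := by linarith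
          have a2 : (n:ℝ) - 3 ≠ 0 := by linarith
          have a3 : (n:ℝ) ≠ 0 := by linarith
          field_simp
          norm_num
        linarith)
    refine le_trans (mul_le_mul_of_nonneg_right ?_ hlog.le) hb
    rw [one_div_div]
    have : 0 ≤ (n:ℝ) * (n - 3) := by nlinarith
    nlinarith
end MPart

section LPart
open Matrix

theorem idx_ne {n : ℕ} (k : Fin (n - 2)) : idx1 k ≠ idx2 k := by
  intro h; have := congrArg Fin.val h; simp [idx1, idx2] at this

theorem lcom_uniq {n : ℕ} (x : LCOM n) {a : LLabel n} {k k' : Fin (n - 1)} (h : a ∈ x.1 k) (h' : a ∈ x.1 k') :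
    k = k' := by
  obtain ⟨m, _, hm⟩ := x.2.2.1 a
  rw [hm k h, hm k' h']

theorem mem_lswap {n : ℕ} (x : LCOM n) (k : Fin (n - 2)) {l1 l2 : LLabel n} (h1 : l1 ∈ x.1 (idx1 k))
    (h2 : l2 ∈ x.1 (idx2 k)) (a : LLabel n) (i : Fin (n - 1)) :
    a ∈ lswapFun n x.1 k l1 l2 i ↔ Equiv.swap l1 l2 a ∈ x.1 i := by
  have hne : l1 ≠ l2 := by
    rintro rfl
    exact idx_ne k (lcom_uniq x h1 h2)
  have u1 : ∀ i, l1 ∈ x.1 i ↔ i = idx1 k := fun i => ⟨fun h => lcom_uniq x h h1, fun h => h ▸ h1⟩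
  have u2 : ∀ i, l2 ∈ x.1 i ↔ i = idx2 k := fun i => ⟨fun h => lcom_uniq x h h2, fun h => h ▸ h2⟩
  unfold lswapFun
  have hk := idx_ne k
  by_cases ha1 : a = l1
  · subst ha1
    rw [Equiv.swap_apply_left, u2]
    split_ifs with c1 c2
    · subst c1; simp [hne, hk]
    · simp [c2]
    · rw [u1]; simp [c1, c2]
  · by_cases ha2 : a = l2
    · subst ha2
      rw [Equiv.swap_apply_right, u1]
      split_ifs with c1 c2
      · simp [c1]
      · subst c2; simp [ha1, hk.symm]
      · rw [u2]; simp [c1, c2]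
    · rw [Equiv.swap_apply_of_ne_of_ne ha1 ha2]
      split_ifs with c1 c2
      · subst c1; simp [ha1, ha2]
      · subst c2; simp [ha1, ha2]
      · rfl

theorem lswap_card {n : ℕ} (x : LCOM n) (k : Fin (n - 2)) {l1 l2 : LLabel n} (h1 : l1 ∈ x.1 (idx1 k))
    (h2 : l2 ∈ x.1 (idx2 k)) (i : Fin (n - 1)) : (lswapFun n x.1 k l1 l2 i).card = 2 := by
  have : lswapFun n x.1 k l1 l2 i = (x.1 i).map (Equiv.swap l1 l2).toEmbedding := by
    ext a
    rw [mem_lswap x k h1 h2]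
    simp only [Finset.mem_map_equiv, Equiv.symm_swap]
  rw [this, Finset.card_map]
  exact x.2.1 i

theorem lswap_part {n : ℕ} (x : LCOM n) (k : Fin (n - 2)) {l1 l2 : LLabel n} (h1 : l1 ∈ x.1 (idx1 k))
    (h2 : l2 ∈ x.1 (idx2 k)) (a : LLabel n) :
    ∃ i, a ∈ lswapFun n x.1 k l1 l2 i ∧ ∀ k', a ∈ lswapFun n x.1 k l1 l2 k' → k' = i := by
  simp only [mem_lswap x k h1 h2]
  exact x.2.2.1 _

theorem lswap_valid {n : ℕ} (x : LCOM n) (k : Fin (n - 2)) {l1 l2 : LLabel n} (h1 : l1 ∈ x.1 (idx1 k))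
    (h2 : l2 ∈ x.1 (idx2 k)) (h : ∀ j, l2 = Sum.inr j → (j : ℕ) < k) : IsLCOM n (lswapFun n x.1 k l1 l2) := by
  refine ⟨lswap_card x k h1 h2, lswap_part x k h1 h2, ?_⟩
  intro j i hj
  rw [mem_lswap x k h1 h2] at hj
  by_cases e1 : Sum.inr j = l1
  · rw [e1, Equiv.swap_apply_left] at hj
    rw [lcom_uniq x hj h2]
    have := x.2.2.2 j (idx1 k) (e1 ▸ h1)
    simp [idx1, idx2] at this ⊢
    omega
  · by_cases e2 : Sum.inr j = l2
    · rw [e2, Equiv.swap_apply_right] at hj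
      rw [lcom_uniq x hj h1]
      have := h j e2.symm
      simpa [idx1] using this
    · rw [Equiv.swap_apply_of_ne_of_ne e1 e2] at hj
      exact x.2.2.2 j i hj

def lD (n : ℕ) (x : LCOM n) (k : Fin (n - 2)) (l1 l2 : LLabel n) : LCOM n :=
  if h : IsLCOM n (lswapFun n x.1 k l1 l2) then ⟨_, h⟩ else x

theorem lD_val (n : ℕ) (x : LCOM n) (k : Fin (n - 2)) (l1 l2 : LLabel n) :
    (lD n x k l1 l2).1 = lswapDest n x k l1 l2 := by
  unfold lD lswapDest
  split_ifs <;> rfl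

theorem PL_act (n : ℕ) (f : LCOM n → ℝ) (x : LCOM n) :
    (PLmat n *ᵥ f) x = (1 / ((n : ℝ) - 2)) * ∑ k : Fin (n - 2),
      ∑ l1 ∈ x.val (idx1 k), ∑ l2 ∈ x.val (idx2 k), (1 / 4 : ℝ) * f (lD n x k l1 l2) := by
  have : (PLmat n *ᵥ f) x = ∑ z, PL n x z * f z := rfl
  rw [this]
  have e : ∀ z, PL n x z * f z = (1 / ((n : ℝ) - 2)) * ∑ k : Fin (n - 2), ∑ l1 ∈ x.val (idx1 k),
      ∑ l2 ∈ x.val (idx2 k), (1 / 4 : ℝ) * (if lswapDest n x k l1 l2 = z.val then 1 else 0) * f z := by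
    intro z
    unfold PL
    simp only [mul_assoc, Finset.sum_mul]
  simp only [e]
  rw [← Finset.mul_sum, Finset.sum_comm]
  congr 1
  refine Finset.sum_congr rfl fun k _ => ?_
  rw [Finset.sum_comm]
  refine Finset.sum_congr rfl fun l1 _ => ?_
  rw [Finset.sum_comm]
  refine Finset.sum_congr rfl fun l2 _ => ?_
  rw [Finset.sum_eq_single (lD n x k l1 l2)]
  · simp [lD_val]
  · intro b _ hb
    rw [← lD_val, if_neg (fun h => hb (Subtype.ext h).symm)]; simp
  · simp

theorem PL_sto (n : ℕ) (hn : 4 ≤ n) : Sto (PLmat n) := by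
  have hn' : (4:ℝ) ≤ n := by exact_mod_cast hn
  constructor
  · intro x y
    show 0 ≤ PL n x y
    unfold PL
    have : (0:ℝ) ≤ 1 / ((n:ℝ) - 2) := by apply div_nonneg <;> linarith
    refine mul_nonneg this (Finset.sum_nonneg fun k _ => Finset.sum_nonneg fun _ _ => Finset.sum_nonneg fun _ _ => ?_)
    split_ifs <;> norm_num
  · intro x
    have h := PL_act n (fun _ => 1) x
    have e : (PLmat n *ᵥ fun _ => (1:ℝ)) x = ∑ z, PLmat n x z := by
      simp [Matrix.mulVec, dotProduct]
    rw [e] at h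
    rw [h]
    simp only [Finset.sum_const, x.2.1]
    simp [Nat.cast_sub (show 2 ≤ n by omega)]
    have : (n:ℝ) - 2 ≠ 0 := by linarith
    field_simp
    norm_num

end LPart

section LPart2
open Matrix

def tripS {n : ℕ} (k : Fin (n - 2)) : Finset (LCOM n × LLabel n × LLabel n) :=
  Finset.univ.filter fun t => t.2.1 ∈ t.1.1 (idx1 k) ∧ t.2.2 ∈ t.1.1 (idx2 k)

def tripPhi {n : ℕ} (k : Fin (n - 2)) (t : LCOM n × LLabel n × LLabel n) : LCOM n × LLabel n × LLabel n :=
  if IsLCOM n (lswapFun n t.1.1 k t.2.1 t.2.2) then (lD n t.1 k t.2.1 t.2.2, t.2.2, t.2.1) else t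

theorem lD_pos {n : ℕ} {x : LCOM n} {k : Fin (n - 2)} {l1 l2 : LLabel n} (h : IsLCOM n (lswapFun n x.1 k l1 l2)) :
    lD n x k l1 l2 = ⟨_, h⟩ := dif_pos h

theorem lD_neg {n : ℕ} {x : LCOM n} {k : Fin (n - 2)} {l1 l2 : LLabel n} (h : ¬ IsLCOM n (lswapFun n x.1 k l1 l2)) :
    lD n x k l1 l2 = x := dif_neg h

theorem lD_back {n : ℕ} {x : LCOM n} {k : Fin (n - 2)} {l1 l2 : LLabel n} (h1 : l1 ∈ x.1 (idx1 k))
    (h2 : l2 ∈ x.1 (idx2 k)) (h : IsLCOM n (lswapFun n x.1 k l1 l2)) :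
    l2 ∈ (lD n x k l1 l2).1 (idx1 k) ∧ l1 ∈ (lD n x k l1 l2).1 (idx2 k) ∧
      lswapFun n (lD n x k l1 l2).1 k l2 l1 = x.1 := by
  rw [lD_pos h]
  have m1 : l2 ∈ lswapFun n x.1 k l1 l2 (idx1 k) := by
    rw [mem_lswap x k h1 h2, Equiv.swap_apply_right]; exact h1
  have m2 : l1 ∈ lswapFun n x.1 k l1 l2 (idx2 k) := by
    rw [mem_lswap x k h1 h2, Equiv.swap_apply_left]; exact h2
  refine ⟨m1, m2, ?_⟩
  funext i
  ext a
  have := mem_lswap (⟨_, h⟩ : LCOM n) k m1 m2 a i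
  rw [this]
  show _ ∈ lswapFun n x.1 k l1 l2 i ↔ _
  rw [mem_lswap x k h1 h2, Equiv.swap_comm l2 l1, Equiv.swap_apply_self]

theorem trip_spec {n : ℕ} (k : Fin (n - 2)) (t : LCOM n × LLabel n × LLabel n) (ht : t ∈ tripS k) :
    tripPhi k t ∈ tripS k ∧ tripPhi k (tripPhi k t) = t ∧ (tripPhi k t).1 = lD n t.1 k t.2.1 t.2.2 := by
  obtain ⟨x, l1, l2⟩ := t
  simp only [tripS, Finset.mem_filter, Finset.mem_univ, true_and] at ht
  by_cases h : IsLCOM n (lswapFun n x.1 k l1 l2)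
  · have e : tripPhi k (x, l1, l2) = (lD n x k l1 l2, l2, l1) := if_pos h
    obtain ⟨b1, b2, b3⟩ := lD_back ht.1 ht.2 h
    rw [e]
    refine ⟨by simp [tripS, b1, b2], ?_, rfl⟩
    have h' : IsLCOM n (lswapFun n (lD n x k l1 l2).1 k l2 l1) := by rw [b3]; exact x.2
    have e2 : tripPhi k (lD n x k l1 l2, l2, l1) = (lD n (lD n x k l1 l2) k l2 l1, l1, l2) := if_pos h'
    rw [e2, lD_pos h']
    congr 1
    exact Subtype.ext b3
  · have e : tripPhi k (x, l1, l2) = (x, l1, l2) := if_neg h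
    rw [e, e]
    exact ⟨by simp [tripS, ht], rfl, (lD_neg h).symm⟩

theorem trip_sum {n : ℕ} (k : Fin (n - 2)) (g : LCOM n → LLabel n → LLabel n → ℝ) :
    ∑ x : LCOM n, ∑ l1 ∈ x.1 (idx1 k), ∑ l2 ∈ x.1 (idx2 k), g x l1 l2 = ∑ t ∈ tripS k, g t.1 t.2.1 t.2.2 := by
  unfold tripS
  rw [Finset.sum_filter, Fintype.sum_prod_type]
  refine Finset.sum_congr rfl fun x _ => ?_
  rw [Fintype.sum_prod_type, ← Finset.sum_filter_add_sum_filter_not Finset.univ (fun a => a ∈ x.1 (idx1 k))]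
  rw [Finset.sum_eq_zero (s := Finset.univ.filter fun a => ¬ a ∈ x.1 (idx1 k)), add_zero]
  · refine Finset.sum_congr (by ext; simp) fun l1 h1 => ?_
    simp only [Finset.mem_filter, Finset.mem_univ, true_and] at h1
    simp [h1, ← Finset.sum_filter]
  · intro l1 h1
    simp only [Finset.mem_filter, Finset.mem_univ, true_and] at h1
    simp [h1]

theorem PL_sum {n : ℕ} (hn : 4 ≤ n) (f : LCOM n → ℝ) : ∑ x, (PLmat n *ᵥ f) x = ∑ x, f x := by
  have hn' : (4:ℝ) ≤ n := by exact_mod_cast hn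
  have hn2 : (n:ℝ) - 2 ≠ 0 := by linarith
  simp only [PL_act]
  rw [← Finset.mul_sum, Finset.sum_comm]
  have : ∀ k : Fin (n - 2), ∑ x : LCOM n, ∑ l1 ∈ x.1 (idx1 k), ∑ l2 ∈ x.1 (idx2 k), (1 / 4 : ℝ) * f (lD n x k l1 l2) =
      ∑ x, f x := by
    intro k
    rw [trip_sum k (fun x l1 l2 => (1 / 4 : ℝ) * f (lD n x k l1 l2))]
    have : ∑ t ∈ tripS k, (1 / 4 : ℝ) * f (lD n t.1 k t.2.1 t.2.2) = ∑ t ∈ tripS k, (1 / 4 : ℝ) * f t.1 := by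
      refine Finset.sum_nbij' (tripPhi k) (tripPhi k) ?_ ?_ ?_ ?_ ?_
      · exact fun t ht => (trip_spec k t ht).1
      · exact fun t ht => (trip_spec k t ht).1
      · exact fun t ht => (trip_spec k t ht).2.1
      · exact fun t ht => (trip_spec k t ht).2.1
      · exact fun t ht => by rw [(trip_spec k t ht).2.2]
    rw [this, ← trip_sum k (fun x _ _ => (1 / 4 : ℝ) * f x)]
    refine Finset.sum_congr rfl fun x _ => ?_
    simp only [Finset.sum_const, x.2.1]
    simp; ring
  simp only [this]
  simp [Nat.cast_sub (show 2 ≤ n by omega)]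
  field_simp

theorem unif_stat {n : ℕ} (hn : 4 ≤ n) : unifL n ᵥ* PLmat n = unifL n := by
  funext y
  have h := PL_sum hn (Pi.single y 1)
  simp only [Matrix.mulVec_single_one, Matrix.col_apply] at h
  show ∑ x, unifL n x * PLmat n x y = _
  unfold unifL
  rw [← Finset.mul_sum]
  have : ∑ x, PLmat n x y = 1 := by rw [h]; simp
  rw [this, mul_one]

def lproj {n : ℕ} (hn : 4 ≤ n) : LLabel n → Fin (n - 1)
  | Sum.inl _ => ⟨0, by omega⟩
  | Sum.inr j => idx2 j

theorem lproj_val {n : ℕ} (hn : 4 ≤ n) (p : Fin (n - 1) → Finset (LLabel n)) (hc : ∀ k, (p k).card = 2)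
    (hp : ∀ a : LLabel n, ∃ k, a ∈ p k ∧ ∀ k', a ∈ p k' → k' = k) :
    IsUCOMraw n (fun k => (p k).val.map (lproj hn)) ↔ IsLCOM n p := by
  constructor
  · rintro ⟨_, _, h⟩
    refine ⟨hc, hp, fun j k hj => ?_⟩
    have := h (idx2 j) k (by simp [idx2]) (Multiset.mem_map.2 ⟨Sum.inr j, hj, rfl⟩)
    simp [idx2] at this
    omega
  · rintro ⟨_, _, h⟩
    refine ⟨fun k => by simpa using hc k, ?_, ?_⟩
    · intro s
      have e1 : ∀ k, ((p k).val.map (lproj hn)).count s = ∑ a : LLabel n, if a ∈ p k then (if lproj hn a = s then 1 else 0) else 0 := by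
        intro k
        rw [Multiset.count_map, ← Finset.sum_filter]
        have : (Multiset.filter (fun a => s = lproj hn a) (p k).val).card = ((p k).filter fun a => lproj hn a = s).card := by
          rw [Finset.card_def, Finset.filter_val]
          simp only [eq_comm]
        rw [this, Finset.card_filter]
        refine Finset.sum_congr (by ext; simp) fun _ _ => rfl
      simp only [e1]
      rw [Finset.sum_comm]
      have e2 : ∀ a : LLabel n, (∑ k, if a ∈ p k then (if lproj hn a = s then 1 else 0) else 0) = if lproj hn a = s then 1 else 0 := by
        intro a
        obtain ⟨k, hk, hu⟩ := hp a
        rw [Finset.sum_eq_single k]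
        · simp [hk]
        · intro b _ hb
          rw [if_neg (fun h => hb (hu b h))]
        · simp
      simp only [e2]
      rw [Fintype.sum_sum_type]
      by_cases hs : (s : ℕ) = 0
      · have : s = ⟨0, by omega⟩ := Fin.ext hs
        simp [lproj, this, idx2]
      · obtain ⟨j, rfl⟩ := exists_idx2 s hs
        have h0 : ∀ j' : Fin (n - 2), idx2 j' = idx2 j ↔ j' = j := fun j' => idx2_inj.eq_iff
        have h1 : (⟨0, by omega⟩ : Fin (n - 1)) ≠ idx2 j := by
          intro h; have := congrArg Fin.val h; simp [idx2] at this
        simp [lproj, h0, h1, hs]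
    · intro j k hj hm
      obtain ⟨a, ha, rfl⟩ := Multiset.mem_map.1 hm
      cases a with
      | inl i => simp [lproj] at hj
      | inr i =>
        have := h i k ha
        simp [lproj, idx2]
        omega

def qL {n : ℕ} (hn : 4 ≤ n) (x : LCOM n) : UCOM n :=
  ⟨fun k => ⟨(x.1 k).val.map (lproj hn), by simpa using x.2.1 k⟩, (lproj_val hn x.1 x.2.1 x.2.2.1).2 x.2⟩

theorem uraw_qL {n : ℕ} (hn : 4 ≤ n) (x : LCOM n) : uraw n (qL hn x) = fun k => (x.1 k).val.map (lproj hn) := rfl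

theorem uswap_proj {n : ℕ} (hn : 4 ≤ n) (x : LCOM n) (k : Fin (n - 2)) {l1 l2 : LLabel n} (h1 : l1 ∈ x.1 (idx1 k))
    (h2 : l2 ∈ x.1 (idx2 k)) :
    uswapFun n (uraw n (qL hn x)) k (lproj hn l1) (lproj hn l2) =
      fun i => (lswapFun n x.1 k l1 l2 i).val.map (lproj hn) := by
  have n2 : l2 ∉ (x.1 (idx1 k)).erase l1 := fun h => idx_ne k (lcom_uniq x (Finset.mem_of_mem_erase h) h2)
  have n1 : l1 ∉ (x.1 (idx2 k)).erase l2 := fun h => idx_ne k (lcom_uniq x h1 (Finset.mem_of_mem_erase h))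
  funext i
  rw [uraw_qL]
  unfold uswapFun lswapFun
  split_ifs with c1 c2
  · rw [Finset.insert_val_of_notMem n2, Multiset.map_cons, Finset.erase_val, Multiset.map_erase_of_mem _ _ h1]
  · rw [Finset.insert_val_of_notMem n1, Multiset.map_cons, Finset.erase_val, Multiset.map_erase_of_mem _ _ h2]
  · rfl

theorem qL_lD {n : ℕ} (hn : 4 ≤ n) (x : LCOM n) (k : Fin (n - 2)) {l1 l2 : LLabel n} (h1 : l1 ∈ x.1 (idx1 k))
    (h2 : l2 ∈ x.1 (idx2 k)) :
    uD n (qL hn x) k (lproj hn l1) (lproj hn l2) = qL hn (lD n x k l1 l2) := by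
  apply uraw_inj
  rw [uraw_uD, uraw_qL, lD_val]
  have hv := lproj_val hn _ (lswap_card x k h1 h2) (lswap_part x k h1 h2)
  rw [← uswap_proj hn x k h1 h2] at hv
  unfold uswapDest lswapDest
  by_cases h : IsLCOM n (lswapFun n x.1 k l1 l2)
  · rw [if_pos h, if_pos (hv.2 h), uswap_proj hn x k h1 h2]
  · rw [if_neg h, if_neg (fun h' => h (hv.1 h')), uraw_qL]

theorem PL_lump {n : ℕ} (hn : 4 ≤ n) : Lump (PLmat n) (PUmat n) (qL hn) := by
  intro f
  funext x
  rw [PL_act]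
  show _ = (PUmat n *ᵥ f) (qL hn x)
  rw [PU_act, uraw_qL]
  congr 1
  refine Finset.sum_congr rfl fun k _ => ?_
  rw [Multiset.map_map]
  refine Finset.sum_congr rfl fun l1 h1 => ?_
  show _ = (Multiset.map _ _).sum
  rw [Multiset.map_map]
  refine Finset.sum_congr rfl fun l2 h2 => ?_
  simp only [Function.comp]
  rw [qL_lD hn x k h1 h2]

theorem qL_surj {n : ℕ} (hn : 4 ≤ n) : Function.Surjective (qL hn) := by
  intro T
  have hc : 0 < Fintype.card {v : VC n // rV v = T} := by rw [fibre_card hn]; positivity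
  obtain ⟨⟨v, rfl⟩⟩ := Fintype.card_pos_iff.1 hc
  obtain ⟨_, hcount, _⟩ := v.2
  have z0 : 0 < n - 1 := by omega
  have hz : Fintype.card {s : Slot n // v.1 s = ⟨0, z0⟩} = n := by
    have := hcount ⟨0, z0⟩
    rw [count_vraw] at this
    rw [Fintype.card_subtype]
    simpa using this
  let e : {s : Slot n // v.1 s = ⟨0, z0⟩} ≃ Fin n := Fintype.equivFinOfCardEq hz
  have hj : ∀ j : Fin (n - 2), ∃ s, ∀ s', v.1 s' = idx2 j ↔ s' = s := by
    intro j
    have := hcount (idx2 j)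
    rw [count_vraw] at this
    rw [if_neg (by simp [idx2])] at this
    obtain ⟨s, hs⟩ := Finset.card_eq_one.1 this
    refine ⟨s, fun s' => ?_⟩
    have := Finset.ext_iff.1 hs s'
    simpa using this
  have h0j : ∀ j : Fin (n - 2), idx2 j ≠ ⟨0, z0⟩ := by
    intro j h; have := congrArg Fin.val h; simp [idx2] at this
  choose σ hσ using hj
  -- positions of labels
  let pos : LLabel n → Slot n := Sum.elim (fun i => (e.symm i).1) σ
  have hproj : ∀ a, v.1 (pos a) = lproj hn a := by
    rintro (i | j)
    · exact (e.symm i).2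
    · exact (hσ j _).2 rfl
  have hinj : Function.Injective pos := by
    rintro (i | j) (i' | j') h
    · have : e.symm i = e.symm i' := Subtype.ext h
      rw [e.symm.injective this]
    · exfalso
      have := congrArg v.1 h
      rw [hproj, hproj] at this
      exact h0j _ this.symm
    · exfalso
      have := congrArg v.1 h
      rw [hproj, hproj] at this
      exact h0j _ this
    · have := congrArg v.1 h
      rw [hproj, hproj] at this
      rw [idx2_inj this]
  have hsurj : Function.Surjective pos := by
    intro s
    by_cases hs : ((v.1 s : Fin (n - 1)) : ℕ) = 0
    · exact ⟨Sum.inl (e ⟨s, Fin.ext hs⟩), by simp [pos]⟩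
    · obtain ⟨j, hj⟩ := exists_idx2 _ hs
      exact ⟨Sum.inr j, ((hσ j s).1 hj).symm⟩
  let E : LLabel n ≃ Slot n := Equiv.ofBijective pos ⟨hinj, hsurj⟩
  have hE : ∀ s, v.1 s = lproj hn (E.symm s) := by
    intro s
    rw [← hproj]
    exact congrArg v.1 (E.apply_symm_apply s).symm
  let p : Fin (n - 1) → Finset (LLabel n) := fun k => {E.symm (k, false), E.symm (k, true)}
  have hne : ∀ k : Fin (n - 1), E.symm (k, false) ≠ E.symm (k, true) := by
    intro k h; have := E.symm.injective h; simp at this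
  have hpc : ∀ k, (p k).card = 2 := fun k => Finset.card_pair (hne k)
  have hmem : ∀ a k, a ∈ p k ↔ (E a).1 = k := by
    intro a k
    simp only [p, Finset.mem_insert, Finset.mem_singleton, Equiv.eq_symm_apply]
    rcases h : E a with ⟨i, b⟩
    cases b <;> simp
  have hpp : ∀ a : LLabel n, ∃ k, a ∈ p k ∧ ∀ k', a ∈ p k' → k' = k := by
    intro a
    refine ⟨(E a).1, (hmem _ _).2 rfl, fun k' h => ((hmem _ _).1 h).symm⟩
  have hv : (fun k => (p k).val.map (lproj hn)) = vraw v.1 := by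
    funext k
    have : (p k).val = {E.symm (k, false), E.symm (k, true)} := by
      show (insert _ _ : Finset _).val = _
      rw [Finset.insert_val_of_notMem (by simpa using hne k)]
      rfl
    rw [this]
    simp [vraw, hE]
  have hL : IsLCOM n p := (lproj_val hn p hpc hpp).1 (by rw [hv]; exact v.2)
  refine ⟨⟨p, hL⟩, ?_⟩
  apply uraw_inj
  rw [uraw_qL]
  exact hv

end LPart2

section LPart3
open Matrix

noncomputable def lpos {n : ℕ} (x : LCOM n) (a : LLabel n) : Fin (n - 1) := Classical.choose (x.2.2.1 a)

theorem mem_iff_lpos {n : ℕ} (x : LCOM n) (a : LLabel n) (k : Fin (n - 1)) : a ∈ x.1 k ↔ lpos x a = k := by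
  have h := (Classical.choose_spec (x.2.2.1 a)).1
  constructor
  · intro h'; exact lcom_uniq x h h'
  · rintro rfl; exact h

def lwt {n : ℕ} : LLabel n → ℤ
  | Sum.inl i => (n : ℤ) - (i : ℕ)
  | Sum.inr j => 2 * (n : ℤ) - (j : ℕ)

noncomputable def lPhi {n : ℕ} (x : LCOM n) : ℤ := ∑ a, lwt a * ((lpos x a : ℕ) : ℤ)

theorem lPhi_nonneg {n : ℕ} (x : LCOM n) : 0 ≤ lPhi x := by
  refine Finset.sum_nonneg fun a _ => mul_nonneg ?_ (by positivity)
  rcases a with i | j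
  · have := i.2; simp only [lwt]; omega
  · have := j.2; simp only [lwt]; omega

theorem lPhi_lt {n : ℕ} (x : LCOM n) (k : Fin (n - 2)) {l1 l2 : LLabel n} (h1 : l1 ∈ x.1 (idx1 k))
    (h2 : l2 ∈ x.1 (idx2 k)) (h : IsLCOM n (lswapFun n x.1 k l1 l2)) (hw : lwt l1 < lwt l2) :
    lPhi (lD n x k l1 l2) < lPhi x := by
  have hne : l1 ≠ l2 := by
    rintro rfl
    exact idx_ne k (lcom_uniq x h1 h2)
  have e : ∀ a, lpos (lD n x k l1 l2) a = lpos x (Equiv.swap l1 l2 a) := by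
    intro a
    rw [← mem_iff_lpos, lD_pos h]
    show a ∈ lswapFun n x.1 k l1 l2 _
    rw [mem_lswap x k h1 h2, mem_iff_lpos]
  have e2 : lPhi (lD n x k l1 l2) = ∑ a, lwt (Equiv.swap l1 l2 a) * ((lpos x a : ℕ) : ℤ) := by
    unfold lPhi
    simp only [e]
    rw [← Equiv.sum_comp (Equiv.swap l1 l2)]
    simp only [Equiv.swap_apply_self]
  rw [← sub_pos, e2]
  unfold lPhi
  rw [← Finset.sum_sub_distrib, Fintype.sum_eq_add l1 l2 hne]
  · rw [(mem_iff_lpos x _ _).1 h1, (mem_iff_lpos x _ _).1 h2, Equiv.swap_apply_left, Equiv.swap_apply_right]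
    simp only [idx1, idx2]
    push_cast
    nlinarith
  · rintro a ⟨ha1, ha2⟩
    rw [Equiv.swap_apply_of_ne_of_ne ha1 ha2]; ring

def LM {n : ℕ} (x : LCOM n) : Prop := ∀ (k : Fin (n - 2)) (l1 l2 : LLabel n), l1 ∈ x.1 (idx1 k) → l2 ∈ x.1 (idx2 k) →
  lwt l1 < lwt l2 → ¬ IsLCOM n (lswapFun n x.1 k l1 l2)

theorem LM_inr {n : ℕ} {x : LCOM n} (hx : LM x) : ∀ (m : ℕ) (hm : m < n - 1) (j : Fin (n - 2)),
    Sum.inr j ∈ x.1 ⟨m, hm⟩ → (j : ℕ) + 1 = m := by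
  intro m
  induction m with
  | zero =>
    intro hm j hj
    have := x.2.2.2 _ _ hj
    simp at this
  | succ m ih =>
    intro hm j hj
    have hlt := x.2.2.2 _ _ hj
    simp only at hlt
    by_contra hne
    let k : Fin (n - 2) := ⟨m, by omega⟩
    have hk : ∀ l1 ∈ x.1 ⟨m, by omega⟩, ∃ i : Fin (n - 2), l1 = Sum.inr i ∧ (i : ℕ) + 1 = m := by
      intro l1 h1
      rcases l1 with i | i
      · exfalso
        refine hx k (Sum.inl i) (Sum.inr j) h1 hj ?_ (lswap_valid x k h1 hj ?_)
        · have := i.2; have := j.2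
          simp only [lwt]; omega
        · intro j' hj'
          have := Sum.inr_injective hj'
          subst this
          show (j : ℕ) < m
          omega
      · exact ⟨i, rfl, ih _ _ h1⟩
    obtain ⟨a, b, hab, he⟩ := Finset.card_eq_two.1 (x.2.1 ⟨m, by omega⟩)
    obtain ⟨i, rfl, hi⟩ := hk a (by rw [he]; simp)
    obtain ⟨i', rfl, hi'⟩ := hk b (by rw [he]; simp)
    apply hab
    congr 1
    apply Fin.ext
    omega

theorem LM_inr_iff {n : ℕ} {x : LCOM n} (hx : LM x) (k : Fin (n - 1)) (j : Fin (n - 2)) :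
    Sum.inr j ∈ x.1 k ↔ (j : ℕ) + 1 = k := by
  constructor
  · intro h; exact LM_inr hx k k.2 j h
  · intro h
    have := LM_inr hx _ (lpos x (Sum.inr j)).2 j ((mem_iff_lpos x _ _).2 rfl)
    rw [mem_iff_lpos]
    apply Fin.ext
    omega

theorem LM_leaf {n : ℕ} {x : LCOM n} (hx : LM x) (k : Fin (n - 1)) : ∃ i : Fin n, Sum.inl i ∈ x.1 k := by
  obtain ⟨a, b, hab, he⟩ := Finset.card_eq_two.1 (x.2.1 k)
  rcases a with i | i
  · exact ⟨i, by rw [he]; simp⟩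
  · rcases b with i' | i'
    · exact ⟨i', by rw [he]; simp⟩
    · exfalso
      have h1 := (LM_inr_iff hx k i).1 (by rw [he]; simp)
      have h2 := (LM_inr_iff hx k i').1 (by rw [he]; simp)
      apply hab
      congr 1
      apply Fin.ext
      omega

theorem LM_order {n : ℕ} {x : LCOM n} (hx : LM x) (m : ℕ) (hm : m < n - 1) (i : Fin n) (hi : Sum.inl i ∈ x.1 ⟨m, hm⟩) :
    ∀ (d : ℕ) (hd : m + d + 1 < n - 1) (i' : Fin n), Sum.inl i' ∈ x.1 ⟨m + d + 1, hd⟩ → (i : ℕ) < i' := by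
  have step : ∀ (m : ℕ) (hm : m + 1 < n - 1) (i i' : Fin n), Sum.inl i ∈ x.1 ⟨m, by omega⟩ →
      Sum.inl i' ∈ x.1 ⟨m + 1, hm⟩ → (i : ℕ) < i' := by
    intro m hm i i' h1 h2
    by_contra hle
    have hne : (i : ℕ) ≠ i' := by
      intro h
      have : i = i' := Fin.ext h
      subst this
      have := lcom_uniq x h1 h2
      simp at this
    let k : Fin (n - 2) := ⟨m, by omega⟩
    refine hx k (Sum.inl i) (Sum.inl i') h1 h2 ?_ (lswap_valid x k h1 h2 ?_)
    · simp only [lwt]; omega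
    · intro j hj; cases hj
  intro d
  induction d with
  | zero => intro hd i' h'; exact step m hd i i' hi h'
  | succ d ih =>
    intro hd i' h'
    obtain ⟨i0, h0⟩ := LM_leaf hx ⟨m + d + 1, by omega⟩
    have a := ih (by omega) i0 h0
    have b := step (m + d + 1) hd i0 i' h0 h'
    omega

theorem LM_order' {n : ℕ} {x : LCOM n} (hx : LM x) {k k' : Fin (n - 1)} (hk : k < k') {i i' : Fin n}
    (hi : Sum.inl i ∈ x.1 k) (hi' : Sum.inl i' ∈ x.1 k') : (i : ℕ) < i' := by
  have hk' : (k : ℕ) < k' := hk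
  have e : k' = ⟨(k : ℕ) + ((k' : ℕ) - k - 1) + 1, by have := k'.2; omega⟩ := by
    apply Fin.ext
    simp only
    omega
  rw [e] at hi'
  exact LM_order hx k k.2 i hi _ _ i' hi'

theorem LM_uniq {n : ℕ} {x y : LCOM n} (hx : LM x) (hy : LM y) : x = y := by
  apply Subtype.ext
  funext ⟨k, hk⟩
  induction k using Nat.strong_induction_on with
  | _ k ih =>
    have key : ∀ {x y : LCOM n}, LM x → LM y → (∀ m, m < k → ∀ hm, x.1 ⟨m, hm⟩ = y.1 ⟨m, hm⟩) →
        ∀ a ∈ x.1 ⟨k, hk⟩, a ∉ y.1 ⟨k, hk⟩ → ∃ i : Fin n, a = Sum.inl i ∧ ⟨k, hk⟩ < lpos y a := by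
      intro x y hx hy ih a ha hna
      rcases a with i | j
      · refine ⟨i, rfl, ?_⟩
        by_contra hlt
        rw [mem_iff_lpos] at hna
        have hlt' : lpos y (Sum.inl i) < ⟨k, hk⟩ := lt_of_le_of_ne (not_lt.1 hlt) hna
        have h2 : Sum.inl i ∈ y.1 (lpos y (Sum.inl i)) := (mem_iff_lpos _ _ _).2 rfl
        have h3 := ih _ hlt' (lpos y (Sum.inl i)).2
        have h4 : Sum.inl i ∈ x.1 (lpos y (Sum.inl i)) := by
          have h5 : x.1 (lpos y (Sum.inl i)) = y.1 (lpos y (Sum.inl i)) := h3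
          rw [h5]; exact h2
        exact hlt'.ne (lcom_uniq x h4 ha)
      · exact absurd ((LM_inr_iff hy _ j).2 ((LM_inr_iff hx _ j).1 ha)) hna
    by_contra hne
    obtain ⟨a, ha, hna⟩ : ∃ a ∈ x.1 ⟨k, hk⟩, a ∉ y.1 ⟨k, hk⟩ := by
      by_contra hcon
      push Not at hcon
      exact hne (Finset.eq_of_subset_of_card_le hcon (by rw [x.2.1, y.2.1]))
    obtain ⟨b, hb, hnb⟩ : ∃ a ∈ y.1 ⟨k, hk⟩, a ∉ x.1 ⟨k, hk⟩ := by
      by_contra hcon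
      push Not at hcon
      exact hne (Finset.eq_of_subset_of_card_le hcon (by rw [x.2.1, y.2.1])).symm
    obtain ⟨i, rfl, hi⟩ := key hx hy (fun m hm h => ih m hm h) a ha hna
    obtain ⟨i', rfl, hi'⟩ := key hy hx (fun m hm h => (ih m hm h).symm) b hb hnb
    have o1 := LM_order' hy hi hb ((mem_iff_lpos _ _ _).2 rfl)
    have o2 := LM_order' hx hi' ha ((mem_iff_lpos _ _ _).2 rfl)
    omega

theorem PL_pos {n : ℕ} (hn : 4 ≤ n) (x : LCOM n) (k : Fin (n - 2)) {l1 l2 : LLabel n} (h1 : l1 ∈ x.1 (idx1 k))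
    (h2 : l2 ∈ x.1 (idx2 k)) : 0 < PLmat n x (lD n x k l1 l2) := by
  have hn' : (4:ℝ) ≤ n := by exact_mod_cast hn
  show 0 < PL n x _
  unfold PL
  refine mul_pos (by apply div_pos <;> linarith) ?_
  have nn : ∀ k l1 l2, (0:ℝ) ≤ (1 / 4 : ℝ) * (if lswapDest n x k l1 l2 = (lD n x k l1 l2).1 then 1 else 0) := by
    intro k l1 l2; split_ifs <;> norm_num
  have nn' : ∀ (y : LCOM n) k l1 l2, (0:ℝ) ≤ (1 / 4 : ℝ) * (if lswapDest n x k l1 l2 = y.1 then 1 else 0) := by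
    intro y k l1 l2; split_ifs <;> norm_num
  refine Finset.sum_pos' (fun _ _ => Finset.sum_nonneg fun _ _ => Finset.sum_nonneg fun _ _ => nn' _ _ _ _) ⟨k, Finset.mem_univ _, ?_⟩
  refine Finset.sum_pos' (fun _ _ => Finset.sum_nonneg fun _ _ => nn' _ _ _ _) ⟨l1, h1, ?_⟩
  refine Finset.sum_pos' (fun _ _ => nn' _ _ _ _) ⟨l2, h2, ?_⟩
  rw [if_pos (lD_val n x k l1 l2).symm]
  norm_num

theorem PL_loop {n : ℕ} (hn : 4 ≤ n) (x : LCOM n) : 0 < PLmat n x x := by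
  let k : Fin (n - 2) := ⟨n - 3, by omega⟩
  have h2 : Sum.inr k ∈ x.1 (idx2 k) := by
    rw [mem_iff_lpos]
    have := x.2.2.2 k (lpos x (Sum.inr k)) ((mem_iff_lpos _ _ _).2 rfl)
    have h := (lpos x (Sum.inr k)).2
    apply Fin.ext
    simp only [idx2]
    have hk : (k : ℕ) = n - 3 := rfl
    omega
  obtain ⟨l1, h1⟩ : (x.1 (idx1 k)).Nonempty := by
    rw [← Finset.card_pos, x.2.1]; norm_num
  have hnv : ¬ IsLCOM n (lswapFun n x.1 k l1 (Sum.inr k)) := by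
    intro h
    have := h.2.2 k (idx1 k) (by rw [mem_lswap x k h1 h2, Equiv.swap_apply_right]; exact h1)
    simp [idx1] at this
  have := PL_pos hn x k h1 h2
  rwa [lD_neg hnv] at this

theorem pos_mul {n : ℕ} {P Q : Matrix (LCOM n) (LCOM n) ℝ} (hP : Sto P) (hQ : Sto Q) {x y z : LCOM n} (h1 : 0 < P x y)
    (h2 : 0 < Q y z) : 0 < (P * Q) x z := by
  rw [Matrix.mul_apply]
  exact Finset.sum_pos' (fun w _ => mul_nonneg (hP.nn _ _) (hQ.nn _ _)) ⟨y, Finset.mem_univ _, mul_pos h1 h2⟩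

theorem reach_LM {n : ℕ} (hn : 4 ≤ n) : ∀ (N : ℕ) (x : LCOM n), (lPhi x).toNat ≤ N →
    ∃ (y : LCOM n) (t : ℕ), LM y ∧ 0 < (PLmat n ^ t) x y := by
  intro N
  induction N with
  | zero =>
    intro x hx
    by_cases h : LM x
    · exact ⟨x, 0, h, by simp⟩
    · exfalso
      unfold LM at h
      push Not at h
      obtain ⟨k, l1, l2, h1, h2, hw, hv⟩ := h
      have a := lPhi_lt x k h1 h2 hv hw
      have b := lPhi_nonneg (lD n x k l1 l2)
      omega
  | succ N ih =>
    intro x hx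
    by_cases h : LM x
    · exact ⟨x, 0, h, by simp⟩
    · unfold LM at h
      push Not at h
      obtain ⟨k, l1, l2, h1, h2, hw, hv⟩ := h
      have a := lPhi_lt x k h1 h2 hv hw
      have b := lPhi_nonneg (lD n x k l1 l2)
      obtain ⟨y, t, hy, hp⟩ := ih (lD n x k l1 l2) (by omega)
      refine ⟨y, t + 1, hy, ?_⟩
      rw [pow_succ']
      exact pos_mul (PL_sto n hn) ((PL_sto n hn).pow t) (PL_pos hn x k h1 h2) hp

theorem LCOM_ne {n : ℕ} (hn : 4 ≤ n) : Nonempty (LCOM n) := by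
  have : 0 < Fintype.card (VC n) := by
    have h := card_VC hn
    have : (0:ℝ) < Fintype.card (VC n) := by rw [h]; positivity
    exact_mod_cast this
  obtain ⟨v⟩ := Fintype.card_pos_iff.1 this
  exact ⟨(qL_surj hn (rV v)).choose⟩

theorem PL_doeb {n : ℕ} (hn : 4 ≤ n) : Doeb (PLmat n) := by
  obtain ⟨x⟩ := LCOM_ne hn
  obtain ⟨y, _, hy, _⟩ := reach_LM hn _ x le_rfl
  have h : ∀ x, ∃ t, 0 < (PLmat n ^ t) x y := by
    intro x
    obtain ⟨y', t, hy', ht⟩ := reach_LM hn _ x le_rfl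
    rw [LM_uniq hy' hy] at ht
    exact ⟨t, ht⟩
  choose τ hτ using h
  have hs : ∀ s, 0 < (PLmat n ^ s) y y := by
    intro s
    induction s with
    | zero => simp
    | succ s ih =>
      rw [pow_succ]
      exact pos_mul ((PL_sto n hn).pow s) (PL_sto n hn) ih (PL_loop hn y)
  refine ⟨Finset.univ.sup τ, y, fun x => ?_⟩
  have hle : τ x ≤ Finset.univ.sup τ := Finset.le_sup (f := τ) (Finset.mem_univ x)
  obtain ⟨s, hs'⟩ := Nat.exists_eq_add_of_le hle
  rw [hs', pow_add]
  exact pos_mul ((PL_sto n hn).pow _) ((PL_sto n hn).pow _) (hτ x) (hs s)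

theorem unif_sum {n : ℕ} (hn : 4 ≤ n) : ∑ x, unifL n x = 1 := by
  haveI := LCOM_ne hn
  unfold unifL
  have : (Fintype.card (LCOM n) : ℝ) ≠ 0 := by exact_mod_cast Fintype.card_ne_zero
  rw [Finset.sum_const, Finset.card_univ, nsmul_eq_mul]
  field_simp

theorem PU_doeb {n : ℕ} (hn : 4 ≤ n) : Doeb (PUmat n) :=
  Lump.doeb (PL_lump hn) (PL_sto n hn) (qL_surj hn) (PL_doeb hn)

theorem push_unif {n : ℕ} (hn : 4 ≤ n) : push (qL hn) (unifL n) = tajima n := by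
  refine stat_unique (PU_sto n hn) (PU_doeb hn) (Lump.stat (PL_lump hn) (unif_stat hn)) (tajima_stat hn) ?_
  rw [tajima_sum hn]
  have := push_sum (qL hn) (unifL n) (fun _ => 1)
  simp only [mul_one] at this
  rw [this, unif_sum hn]

theorem tU_le_tL {n : ℕ} (hn : 4 ≤ n) : tU n ≤ tL n := by
  unfold tU tL
  rw [← push_unif hn]
  exact Lump.mix_le (PL_lump hn) (PL_sto n hn) (PL_doeb hn) (unif_stat hn) (unif_sum hn) (qL_surj hn)

theorem cubic {n : ℕ} (hn : 4 ≤ n) : (tU n : ℝ) ≥ (1 / 1000 : ℝ) * (n : ℝ) ^ 3 := by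
  obtain ⟨h1, h2⟩ := tU_bound hn (PU_doeb hn)
  by_cases h4 : n = 4
  · subst h4
    have : (1:ℝ) ≤ tU 4 := by exact_mod_cast h1
    norm_num
    linarith
  · have h5 : (5:ℝ) ≤ n := by exact_mod_cast (show 5 ≤ n by omega)
    have hl := Real.log_two_gt_d9
    obtain ⟨m, hm⟩ : ∃ m : ℝ, (n:ℝ) = m + 5 := ⟨n - 5, by ring⟩
    have hm0 : 0 ≤ m := by linarith
    rw [hm] at h2 ⊢
    have hA : 0 ≤ (2 / 90 : ℝ) * ((m + 5) * ((m + 5) + 1) * ((m + 5) - 3)) - 1 := by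
      ring_nf; positivity
    have hB := mul_le_mul_of_nonneg_left (show (1/2 : ℝ) ≤ Real.log 2 by linarith) hA
    refine le_trans ?_ h2
    refine le_trans ?_ hB
    ring_nf
    nlinarith [pow_nonneg hm0 2, pow_nonneg hm0 3]

end LPart3

/-- For `n ≥ 4`, the mixing times `t_n` and `t_n^L` of the adjacent-swap
chains on `COM_n` and `COM^L_n` satisfy `t ≥ ((2/90)·n(n+1)(n−3) − 1)·log 2`; in particular
there is a constant `C₁ > 0` with `t_n ≥ C₁·n³` and `t_n^L ≥ C₁·n³` for all `n ≥ 4`. -/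
theorem stmt16 :
    (∀ n : ℕ, 4 ≤ n →
      ((tU n : ℝ) ≥ ((2 / 90 : ℝ) * ((n : ℝ) * ((n : ℝ) + 1) * ((n : ℝ) - 3)) - 1) *
          Real.log 2 ∧
       (tL n : ℝ) ≥ ((2 / 90 : ℝ) * ((n : ℝ) * ((n : ℝ) + 1) * ((n : ℝ) - 3)) - 1) *
          Real.log 2)) ∧
    ∃ C₁ : ℝ, 0 < C₁ ∧ ∀ n : ℕ, 4 ≤ n →
      (tU n : ℝ) ≥ C₁ * (n : ℝ) ^ 3 ∧ (tL n : ℝ) ≥ C₁ * (n : ℝ) ^ 3 := by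
  have hle : ∀ n : ℕ, 4 ≤ n → (tU n : ℝ) ≤ tL n := fun n hn => by exact_mod_cast tU_le_tL hn
  refine ⟨fun n hn => ?_, 1 / 1000, by norm_num, fun n hn => ?_⟩
  · have h := (tU_bound hn (PU_doeb hn)).2
    exact ⟨h, le_trans h (hle n hn)⟩
  · exact ⟨cubic hn, le_trans (cubic hn) (hle n hn)⟩
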